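/- arXiv:2206.10872 — 3 statements merged into one kernel-verified Lean document; each statement's English description precedes it below -/
import Mathlib

section
/- Let k be a field and α any k-algebra automorphism of the power series ring k[[X]]. Then the skew polynomial ring Ŝ = k[[X]][θ; α] satisfies (◊): the injective hull of every simple right Ŝ-module and of every simple left Ŝ-module is locally Artinian. -/
open MulOpposite

universe u

/-- `φ : R →+* S` and `θ : S` exhibit `S` as the skew polynomial ring `R[θ; α]`:
`θ · r = α(r) · θ`, and every element of `S` is uniquely a polynomial `Σ rᵢ θ^i`. -/
structure IsSkewPolynomialRing {R S : Type u} [CommRing R] [Ring S]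
    (α : R ≃+* R) (φ : R →+* S) (θ : S) : Prop where
  commutes : ∀ r : R, θ * φ r = φ (α r) * θ
  bijective : Function.Bijective fun p : ℕ →₀ R => p.sum fun n r => φ r * θ ^ n

/-- `ψ : S →+* T` exhibits `T` as the (Ore) localization of `S` inverting the
powers of the normal element `x`. -/
structure IsLocalizationAt {S T : Type u} [Ring S] [Ring T] (x : S) (ψ : S →+* T) : Prop where
  inj : Function.Injective ψ
  unit : IsUnit (ψ x)
  surj : ∀ t : T, ∃ (s : S) (n : ℕ), t * ψ x ^ n = ψ s

/-- The right ideal `zS`. -/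
abbrev rSpan (S : Type u) [Ring S] (z : S) : Submodule Sᵐᵒᵖ S := Submodule.span Sᵐᵒᵖ {z}

/-- The left ideal `Sz`. -/
abbrev lSpan (S : Type u) [Ring S] (z : S) : Submodule S S := Submodule.span S {z}

/-- The cyclic right `S`-module `S/zS`. -/
abbrev rQuot (S : Type u) [Ring S] (z : S) : Type u := S ⧸ rSpan S z

/-- The cyclic left `S`-module `S/Sz`. -/
abbrev lQuot (S : Type u) [Ring S] (z : S) : Type u := S ⧸ lSpan S z

/-- The cyclic right `S`-module `S/(aS + bS)`. -/
abbrev rQuot2 (S : Type u) [Ring S] (a b : S) : Type u := S ⧸ (rSpan S a ⊔ rSpan S b)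

/-- Two elements of `T` are similar if `T/aT ≅ T/bT` as right `T`-modules. -/
def SimilarIn (T : Type u) [Ring T] (a b : T) : Prop :=
  Nonempty (rQuot T a ≃ₗ[Tᵐᵒᵖ] rQuot T b)

/-- The image in `S` of a polynomial `p ∈ k[θ]`, i.e. `Σ φ(pᵢ) θ^i`. -/
def thetaPoly {k R S : Type u} [CommSemiring k] [CommRing R] [Ring S] [Algebra k R]
    (φ : R →+* S) (θ : S) (p : Polynomial k) : S :=
  p.sum fun n c => φ (algebraMap k R c) * θ ^ n

/-- Type (A) irreducibles of `S = R[θ; α]`: unit multiples of `X` or `θ`. -/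
def IsTypeA {R S : Type u} [CommRing R] [Ring S] (X : R) (φ : R →+* S) (θ : S) (z : S) : Prop :=
  ∃ u : Sˣ, (u : S) * z = φ X ∨ (u : S) * z = θ

/-- Type (B) irreducibles of `S = R[θ; α]`: unit multiples of `1 + Xs`, `s ∈ S∖R`. -/
def IsTypeB {R S : Type u} [CommRing R] [Ring S] (X : R) (φ : R →+* S) (z : S) : Prop :=
  ∃ (u : Sˣ) (s : S), s ∉ Set.range φ ∧ (u : S) * z = 1 + φ X * s

/-- Type (C) irreducibles of `S = R[θ; α]`: unit multiples of `f + Xs` with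
`f ∈ k[θ]∖k` monic and the element not equal to `θ`. -/
def IsTypeC (k : Type u) {R S : Type u} [CommSemiring k] [CommRing R] [Ring S] [Algebra k R]
    (X : R) (φ : R →+* S) (θ : S) (z : S) : Prop :=
  ∃ (u : Sˣ) (p : Polynomial k) (s : S), p.Monic ∧ 1 ≤ p.natDegree ∧
    (u : S) * z = thetaPoly φ θ p + φ X * s ∧ (u : S) * z ≠ θ

/-- A module is locally Artinian if all its finitely generated submodules are Artinian. -/
def IsLocallyArtinian (A M : Type u) [Ring A] [AddCommGroup M] [Module A M] : Prop :=
  ∀ N : Submodule A M, N.FG → IsArtinian A N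

/-- A submodule is essential if it meets every nonzero submodule nontrivially. -/
def IsEssentialSubmodule {A : Type u} [Ring A] {E : Type u} [AddCommGroup E] [Module A E]
    (U : Submodule A E) : Prop :=
  ∀ W : Submodule A E, W ≠ ⊥ → W ⊓ U ≠ ⊥

/-- `f : V →ₗ[A] E` exhibits `E` as an injective hull of `V`. -/
def IsInjectiveHullVia (A : Type u) [Ring A] {V E : Type u} [AddCommGroup V] [Module A V]
    [AddCommGroup E] [Module A E] (f : V →ₗ[A] E) : Prop :=
  Module.Injective A E ∧ Function.Injective f ∧ IsEssentialSubmodule (LinearMap.range f)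

/-- Property (◊) for left `A`-modules: the injective hull of every simple left `A`-module
is locally Artinian.  (Apply with `A = Sᵐᵒᵖ` for the right-module version.) -/
def HasDiamond (A : Type u) [Ring A] : Prop :=
  ∀ (V E : Type u) [AddCommGroup V] [Module A V] [AddCommGroup E] [Module A E]
    (f : V →ₗ[A] E), IsSimpleModule A V → IsInjectiveHullVia A f → IsLocallyArtinian A E

/-- Gabriel–Rentschler Krull dimension at most `n`; the base case `n = 0` is
`Artinian`, and `Kdim M ≤ n + 1` iff in every descending chain of submodules almost
all successive factors have Krull dimension at most `n`. -/
def KdimLE (A : Type u) [Ring A] : ℕ → ∀ (M : Type u) [AddCommGroup M] [Module A M], Prop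
  | 0, M, _, _ => IsArtinian A M
  | n + 1, M, _, _ =>
      ∀ f : ℕ → Submodule A M, (∀ i, f (i + 1) ≤ f i) →
        ∃ N : ℕ, ∀ i, N ≤ i →
          KdimLE A n (↥(f i) ⧸ Submodule.comap (f i).subtype (f (i + 1)))

/-- A `1`-critical module: Krull dimension exactly `1`, and all proper factors of
Krull dimension `< 1`, i.e. Artinian. -/
def IsOneCritical (A : Type u) [Ring A] (M : Type u) [AddCommGroup M] [Module A M] : Prop :=
  KdimLE A 1 M ∧ ¬ IsArtinian A M ∧ ∀ N : Submodule A M, N ≠ ⊥ → IsArtinian A (M ⧸ N)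

/-- A right `S`-module is `𝒳`-torsion free (`𝒳 = {xⁿ}`). -/
def IsXTorsionFree {S : Type u} [Ring S] (x : S) (M : Type u) [AddCommGroup M]
    [Module Sᵐᵒᵖ M] : Prop :=
  ∀ (m : M) (n : ℕ), op (x ^ n) • m = 0 → m = 0

/-- A right `S`-module is `𝒳`-torsion (`𝒳 = {xⁿ}`). -/
def IsXTorsion {S : Type u} [Ring S] (x : S) (M : Type u) [AddCommGroup M]
    [Module Sᵐᵒᵖ M] : Prop :=
  ∀ m : M, ∃ n : ℕ, op (x ^ n) • m = 0

/-- The central embedding of `k` into `Sᵐᵒᵖ` coming from `k → R → S`. -/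
def opScalars {k R S : Type u} [CommSemiring k] [CommRing R] [Ring S] [Algebra k R]
    (φ : R →+* S) : k →+* Sᵐᵒᵖ where
  toFun c := op (φ (algebraMap k R c))
  map_one' := by simp
  map_mul' x y := by
    show op (φ (algebraMap k R (x * y))) = op (φ (algebraMap k R x)) * op (φ (algebraMap k R y))
    rw [mul_comm x y, map_mul, map_mul, op_mul]
  map_zero' := by simp
  map_add' x y := by
    show op (φ (algebraMap k R (x + y))) = op (φ (algebraMap k R x)) + op (φ (algebraMap k R y))
    rw [map_add, map_add, op_add]

/-- A right `S`-module is finite dimensional over the central subfield `k`. -/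
def FinDimOver (k : Type u) {R S : Type u} [Field k] [CommRing R] [Ring S] [Algebra k R]
    (φ : R →+* S) (M : Type u) [AddCommGroup M] [Module Sᵐᵒᵖ M] : Prop :=
  letI : Module k M := Module.compHom M (opScalars φ)
  Module.Finite k M

/-- A left `S`-module is finite dimensional over the central subfield `k`. -/
def FinDimOverLeft (k : Type u) {R S : Type u} [Field k] [CommRing R] [Ring S] [Algebra k R]
    (φ : R →+* S) (M : Type u) [AddCommGroup M] [Module S M] : Prop :=
  letI : Module k M := Module.compHom M (φ.comp (algebraMap k R))
  Module.Finite k M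

/-- `Ext¹_A(U, V) = 0`: every short exact sequence `0 → V → Y → U → 0` splits. -/
def ExtVanish (A : Type u) [Ring A] (U V : Type u) [AddCommGroup U] [Module A U]
    [AddCommGroup V] [Module A V] : Prop :=
  ∀ (Y : Type u) [AddCommGroup Y] [Module A Y] (i : V →ₗ[A] Y) (p : Y →ₗ[A] U),
    Function.Injective i → Function.Surjective p → LinearMap.range i = LinearMap.ker p →
    ∃ r : Y →ₗ[A] V, r.comp i = LinearMap.id

/-- The right `S`-module `V` is isomorphic, as an `S`-module, to the right `T`-module `Q`
(`T` an `S`-ring via `ψ`). -/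
def SModIsoOfT {S T : Type u} [Ring S] [Ring T] (ψ : S →+* T)
    (V : Type u) [AddCommGroup V] [Module Sᵐᵒᵖ V]
    (Q : Type u) [AddCommGroup Q] [Module Tᵐᵒᵖ Q] : Prop :=
  ∃ e : V ≃+ Q, ∀ (s : S) (v : V), e (op s • v) = op (ψ s) • e v

/-- Two modules are hull-similar: they contain nonzero isomorphic submodules
(equivalently, their injective hulls are isomorphic). -/
def HullSimilar (A : Type u) [Ring A] (M N : Type u) [AddCommGroup M] [Module A M]
    [AddCommGroup N] [Module A N] : Prop :=
  ∃ (P : Submodule A M) (Q : Submodule A N), P ≠ ⊥ ∧ Q ≠ ⊥ ∧ Nonempty (P ≃ₗ[A] Q)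

/-- Restriction of scalars along `ψ : S →+* T` for right modules. -/
def restrictOp {S T : Type u} [Ring S] [Ring T] (ψ : S →+* T)
    (E : Type u) [AddCommGroup E] [Module Tᵐᵒᵖ E] : Module Sᵐᵒᵖ E :=
  Module.compHom E (RingHom.op ψ)

/-- `f : V →+ E` exhibits `E` as an injective hull of the `A`-module `V`,
where `f` is additionally required to be `A`-linear. -/
def IsInjectiveHullViaAdd (A : Type u) [Ring A] {V E : Type u} [AddCommGroup V] [Module A V]
    [AddCommGroup E] [Module A E] (f : V →+ E) : Prop :=
  Module.Injective A E ∧ Function.Injective f ∧ (∀ (a : A) (v : V), f (a • v) = a • f v) ∧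
    ∀ W : Submodule A E, W ≠ ⊥ → ∃ x : E, x ≠ 0 ∧ x ∈ W ∧ x ∈ Set.range f

section Abs
open Pointwise

/-- Elements a nonzero multiple of which lies in `B`. -/
def satur {R M : Type*} [CommRing R] [IsDomain R] [AddCommGroup M] [Module R M]
    (B : Submodule R M) : Submodule R M where
  carrier := {x | ∃ r : R, r ≠ 0 ∧ r • x ∈ B}
  zero_mem' := ⟨1, one_ne_zero, by simp⟩
  add_mem' := by
    rintro x y ⟨r, hr, hx⟩ ⟨s, hs, hy⟩
    refine ⟨r * s, mul_ne_zero hr hs, ?_⟩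
    rw [smul_add]
    refine B.add_mem ?_ ?_
    · rw [mul_comm, mul_smul]; exact B.smul_mem _ hx
    · rw [mul_smul]; exact B.smul_mem _ hy
  smul_mem' := by
    rintro c x ⟨r, hr, hx⟩
    refine ⟨r, hr, ?_⟩
    rw [smul_comm]; exact B.smul_mem _ hx

theorem satur_mono {R M : Type*} [CommRing R] [IsDomain R] [AddCommGroup M] [Module R M]
    {B B' : Submodule R M} (h : B ≤ B') : satur B ≤ satur B' :=
  fun _ ⟨r, hr, hx⟩ => ⟨r, hr, h hx⟩

theorem le_satur {R M : Type*} [CommRing R] [IsDomain R] [AddCommGroup M] [Module R M]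
    (B : Submodule R M) : B ≤ satur B :=
  fun x hx => ⟨1, one_ne_zero, by simpa using hx⟩

theorem satur_of_smul {R M : Type*} [CommRing R] [IsDomain R] [AddCommGroup M] [Module R M]
    {B : Submodule R M} {c : R} (hc : c ≠ 0) {x : M} (h : c • x ∈ satur B) : x ∈ satur B := by
  obtain ⟨r, hr, hx⟩ := h
  exact ⟨r * c, mul_ne_zero hr hc, by rwa [mul_smul]⟩

theorem satur_rank {R M : Type*} [CommRing R] [IsDomain R] [AddCommGroup M] [Module R M]
    (B : Submodule R M) (hB : B.FG) (h : ∀ x, x ∈ satur B) :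
    Module.rank R M < Cardinal.aleph0 := by
  rw [← rank_quotient_add_rank_of_isDomain B]
  have h0 : Module.rank R (M ⧸ B) = 0 := by
    rw [rank_eq_zero_iff]
    intro x
    obtain ⟨x, rfl⟩ := Submodule.Quotient.mk_surjective B x
    obtain ⟨r, hr, hx⟩ := h x
    exact ⟨r, hr, by
      rw [← Submodule.Quotient.mk_smul]; exact (Submodule.Quotient.mk_eq_zero B).mpr hx⟩
  rw [h0, zero_add]
  have : Module.Finite R B := Module.Finite.iff_fg.mpr hB
  exact Module.rank_lt_aleph0 R B

def Algc (R : Type*) {M : Type*} [CommRing R] [IsDomain R] [AddCommGroup M] [Module R M]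
    (Θ : M →+ M) (x : M) : Prop :=
  ∃ B : Submodule R M, B.FG ∧ ∀ n : ℕ, Θ^[n] x ∈ satur B

theorem algc_zero {R M : Type*} [CommRing R] [IsDomain R] [AddCommGroup M] [Module R M]
    (Θ : M →+ M) : Algc R Θ 0 :=
  ⟨⊥, Submodule.fg_bot, fun n => by simp⟩

theorem iter_smul {R M : Type*} [CommRing R] [AddCommGroup M] [Module R M]
    (α : R ≃+* R) (Θ : M →+ M) (hΘ : ∀ (r : R) m, Θ (r • m) = α r • Θ m) (j : ℕ) (r : R) (m : M) :
    Θ^[j] (r • m) = (α^[j] r) • Θ^[j] m := by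
  induction j with
  | zero => rfl
  | succ j ih => rw [Function.iterate_succ_apply', ih, hΘ, ← Function.iterate_succ_apply' α,
      ← Function.iterate_succ_apply' Θ]

theorem algc_step {R M : Type*} [CommRing R] [IsDomain R] [AddCommGroup M] [Module R M]
    (α : R ≃+* R) (Θ : M →+ M) (hΘ : ∀ (r : R) m, Θ (r • m) = α r • Θ m) (x : M) (c : ℕ → R)
    (N : ℕ) (hc : ∃ i < N, c i ≠ 0)
    (hy : Algc R Θ (∑ i ∈ Finset.range N, c i • Θ^[i] x)) : Algc R Θ x := by
  induction N with
  | zero => obtain ⟨i, hi, _⟩ := hc; omega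
  | succ N ih =>
    by_cases h0 : c N = 0
    · rw [Finset.sum_range_succ, h0, zero_smul, add_zero] at hy
      obtain ⟨i, hi, hci⟩ := hc
      refine ih ⟨i, ?_, hci⟩ hy
      rcases Nat.lt_succ_iff_lt_or_eq.mp hi with h | h
      · exact h
      · subst h; exact absurd h0 hci
    · obtain ⟨B, hB, hBy⟩ := hy
      refine ⟨B ⊔ Submodule.span R ((fun i => Θ^[i] x) '' (Set.Iio N)),
        hB.sup (Submodule.fg_span ((Set.finite_Iio N).image _)), ?_⟩
      intro n
      induction n using Nat.strong_induction_on with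
      | _ n IH =>
        by_cases hn : n < N
        · exact le_satur _ (Submodule.mem_sup_right (Submodule.subset_span ⟨n, hn, rfl⟩))
        · obtain ⟨j, rfl⟩ := Nat.exists_eq_add_of_le (not_lt.mp hn)
          have h1 := satur_mono (le_sup_left : B ≤ B ⊔ Submodule.span R ((fun i => Θ^[i] x) '' (Set.Iio N))) (hBy j)
          let T : AddMonoid.End M := Θ
          have e : ∀ z, Θ^[j] z = (T ^ j) z := by
            intro z; rw [AddMonoid.End.coe_pow]; rfl
          rw [e, map_sum, Finset.sum_range_succ] at h1
          have h2 : ∀ i, (T ^ j) (c i • Θ^[i] x) = (α^[j] (c i)) • Θ^[i + j] x := by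
            intro i
            rw [← e, iter_smul α Θ hΘ, ← Function.iterate_add_apply, add_comm j i]
          simp only [h2] at h1
          have h3 := (Submodule.add_mem_iff_right _ (Submodule.sum_mem _ fun i hi =>
            Submodule.smul_mem _ _ (IH (i + j) (by have := Finset.mem_range.mp hi; omega)))).mp h1
          refine satur_of_smul ?_ h3
          have : Function.Injective (α^[j]) := α.injective.iterate j
          intro h; apply h0; apply this; rw [h]
          exact (Function.iterate_fixed (map_zero α) j).symm

end Abs

section PS
open PowerSeries Pointwise

theorem exists_tail {k : Type*} [Field k] (b : ℕ → PowerSeries k) :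
    ∃ t : ℕ → PowerSeries k, ∀ n, t n = b n + X * t (n + 1) := by
  refine ⟨fun n => mk fun m => ∑ p ∈ Finset.HasAntidiagonal.antidiagonal m, coeff p.1 (b (n + p.2)), fun n => ?_⟩
  ext m
  cases m with
  | zero => simp
  | succ m =>
    simp only [coeff_mk, map_add, coeff_succ_X_mul]
    rw [Finset.Nat.sum_antidiagonal_succ']
    simp only [add_zero]
    congr 1
    refine Finset.sum_congr rfl fun p _ => ?_
    rw [show n + (p.2 + 1) = n + 1 + p.2 by ring]

theorem exists_tail_mod {k M : Type*} [Field k] [AddCommGroup M] [Module (PowerSeries k) M]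
    (Q : Submodule (PowerSeries k) M) (hQ : Q.FG) (h : ℕ → M) (hh : ∀ n, h n ∈ Q) :
    ∃ t : ℕ → M, (∀ n, t n ∈ Q) ∧ ∀ n, t n = h n + (X : PowerSeries k) • t (n + 1) := by
  obtain ⟨n, q, rfl⟩ := Submodule.fg_iff_exists_fin_generating_family.mp hQ
  have : ∀ m, ∃ c : Fin n → PowerSeries k, ∑ i, c i • q i = h m := fun m =>
    (Submodule.mem_span_range_iff_exists_fun _).mp (hh m)
  choose c hc using this
  have : ∀ i, ∃ t : ℕ → PowerSeries k, ∀ m, t m = c m i + X * t (m + 1) := fun i => exists_tail _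
  choose t ht using this
  refine ⟨fun m => ∑ i, t i m • q i, fun m => ?_, fun m => ?_⟩
  · exact Submodule.sum_mem _ fun i _ => Submodule.smul_mem _ _ (Submodule.subset_span ⟨i, rfl⟩)
  · rw [← hc, Finset.smul_sum, ← Finset.sum_add_distrib]
    refine Finset.sum_congr rfl fun i _ => ?_
    rw [smul_smul, ← add_smul, ← ht]

theorem span_X_le {k : Type*} [Field k] :
    Ideal.span {(X : PowerSeries k)} ≤ Ideal.jacobson ⊥ := by
  rw [← maximalIdeal_eq_span_X]
  exact IsLocalRing.maximalIdeal_le_jacobson _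

theorem krull_seq {k M : Type*} [Field k] [AddCommGroup M] [Module (PowerSeries k) M]
    (Q : Submodule (PowerSeries k) M) (hQ : Q.FG) (e : ℕ → M) (he : ∀ n, e n ∈ Q)
    (hx : ∀ n, e n = (X : PowerSeries k) • e (n + 1)) : e 0 = 0 := by
  have : Module.Finite (PowerSeries k) Q := Module.Finite.iff_fg.mpr hQ
  let Y : Submodule (PowerSeries k) M := Submodule.span _ (Set.range e)
  have hY : Y ≤ Q := Submodule.span_le.mpr (by rintro _ ⟨n, rfl⟩; exact he n)
  have hYf : Y.FG := by
    have := (isNoetherian_submodule (N := Q)).mp inferInstance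
    exact this Y hY
  have : Y = ⊥ := by
    refine Submodule.eq_bot_of_le_smul_of_le_jacobson_bot (Ideal.span {X}) Y hYf ?_ span_X_le
    refine Submodule.span_le.mpr ?_
    rintro _ ⟨n, rfl⟩
    rw [hx]
    exact Submodule.smul_mem_smul (Ideal.mem_span_singleton_self X) (Submodule.subset_span ⟨_, rfl⟩)
  have h0 : e 0 ∈ Y := Submodule.subset_span ⟨0, rfl⟩
  rw [this] at h0
  simpa using h0

theorem exists_gens.{v} {k : Type*} {M : Type v} [Field k] [AddCommGroup M] [Module (PowerSeries k) M]
    (hX : ∀ m : M, (X : PowerSeries k) • m = 0 → m = 0)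
    (hr : Module.rank (PowerSeries k) M < Cardinal.aleph0) :
    ∃ (ι : Type v) (_ : Fintype ι) (g : ι → M),
      (∀ m, ∃ c : ι → PowerSeries k, ∀ N : ℕ, ∃ y,
        m - ∑ i, c i • g i = (X ^ N : PowerSeries k) • y) ∧
      (∀ c : ι → PowerSeries k, (∀ N : ℕ, ∃ y, ∑ i, c i • g i = (X ^ N : PowerSeries k) • y) →
        c = 0) := by
  let XM : Submodule (PowerSeries k) M := (X : PowerSeries k) • ⊤
  have hXM : ∀ m, m ∈ XM ↔ ∃ y, m = (X : PowerSeries k) • y := by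
    intro m
    simp only [XM, Submodule.mem_smul_pointwise_iff_exists]
    constructor
    · rintro ⟨y, -, rfl⟩; exact ⟨y, rfl⟩
    · rintro ⟨y, rfl⟩; exact ⟨y, trivial, rfl⟩
  letI : Module k (M ⧸ XM) := Module.compHom _ (C : k →+* PowerSeries k)
  have hsm : ∀ (a : k) (q : M ⧸ XM), a • q = (C a : PowerSeries k) • q := fun _ _ => rfl
  have hcc : ∀ (r : PowerSeries k) (m : M), (XM.mkQ (r • m)) = constantCoeff r • XM.mkQ m := by
    intro r m
    rw [hsm, ← map_smul, ← sub_eq_zero, ← map_sub, ← sub_smul]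
    rw [Submodule.mkQ_apply, Submodule.Quotient.mk_eq_zero, hXM]
    have : (X : PowerSeries k) ∣ r - C (constantCoeff r) := by
      rw [X_dvd_iff]; simp
    obtain ⟨s, hs⟩ := this
    exact ⟨s • m, by rw [hs, mul_smul]⟩
  let b := Module.Basis.ofVectorSpace k (M ⧸ XM)
  let ι := Module.Basis.ofVectorSpaceIndex k (M ⧸ XM)
  choose g hg using fun i : ι => XM.mkQ_surjective (b i)
  have key : ∀ (N : ℕ) (s : Finset ι) (c : ι → PowerSeries k),
      (∃ y, ∑ i ∈ s, c i • g i = (X ^ N : PowerSeries k) • y) → ∀ i ∈ s, (X : PowerSeries k) ^ N ∣ c i := by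
    intro N
    induction N with
    | zero => intro s c _ i _; simp
    | succ N ih =>
      rintro s c ⟨y, hy⟩
      have h1 : ∀ i ∈ s, (X : PowerSeries k) ∣ c i := by
        have h2 : XM.mkQ (∑ i ∈ s, c i • g i) = 0 := by
          rw [hy, Submodule.mkQ_apply, Submodule.Quotient.mk_eq_zero, hXM]
          exact ⟨(X ^ N : PowerSeries k) • y, by rw [smul_smul, pow_succ']⟩
        rw [map_sum] at h2
        simp only [hcc, hg] at h2
        intro i hi
        rw [X_dvd_iff]
        exact linearIndependent_iff'.mp b.linearIndependent s _ h2 i hi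
      have h3 : ∀ i, ∃ d, i ∈ s → c i = X * d := by
        intro i
        by_cases hi : i ∈ s
        · obtain ⟨d, hd⟩ := h1 i hi; exact ⟨d, fun _ => hd⟩
        · exact ⟨0, fun h => absurd h hi⟩
      choose d hd using h3
      have h4 : ∑ i ∈ s, d i • g i = (X ^ N : PowerSeries k) • y := by
        rw [← sub_eq_zero]
        apply hX
        rw [smul_sub, smul_smul, ← pow_succ', ← hy, Finset.smul_sum, sub_eq_zero]
        refine Finset.sum_congr rfl fun i hi => ?_
        rw [smul_smul, hd i hi]
      intro i hi
      rw [hd i hi, pow_succ']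
      exact mul_dvd_mul_left _ (ih s d ⟨y, h4⟩ i hi)
  have hzero : ∀ r : PowerSeries k, (∀ N, (X : PowerSeries k) ^ N ∣ r) → r = 0 := by
    intro r h
    ext n
    exact X_pow_dvd_iff.mp (h (n + 1)) n (Nat.lt_succ_self n)
  have hli : LinearIndependent (PowerSeries k) g := by
    rw [linearIndependent_iff']
    intro s c hs i hi
    exact hzero _ fun N => key N s c ⟨0, by rw [hs, smul_zero]⟩ i hi
  have hfin : Finite ι := by
    rw [← Cardinal.lt_aleph0_iff_finite]
    exact lt_of_le_of_lt hli.cardinal_le_rank hr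
  let _ := Fintype.ofFinite ι
  refine ⟨ι, inferInstance, g, ?_, ?_⟩
  · have hgen : ∀ m : M, ∃ (a : ι → PowerSeries k) (y : M), m = ∑ i, a i • g i + (X : PowerSeries k) • y := by
      intro m
      refine ⟨fun i => C (b.repr (XM.mkQ m) i), ?_⟩
      have : m - ∑ i, (C (b.repr (XM.mkQ m) i) : PowerSeries k) • g i ∈ XM := by
        rw [← Submodule.Quotient.mk_eq_zero, ← Submodule.mkQ_apply, map_sub, map_sum]
        simp only [hcc, hg, constantCoeff_C]
        rw [b.sum_repr, sub_self]
      obtain ⟨y, hy⟩ := (hXM _).mp this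
      exact ⟨y, by rw [← hy]; abel⟩
    choose a nx hnx using hgen
    intro m
    let ms : ℕ → M := fun n => nx^[n] m
    have hms : ∀ n, ms n = ∑ i, a (ms n) i • g i + (X : PowerSeries k) • ms (n + 1) := by
      intro n
      have : ms (n + 1) = nx (ms n) := Function.iterate_succ_apply' _ _ _
      rw [this]; exact hnx _
    have : ∀ i, ∃ t : ℕ → PowerSeries k, ∀ n, t n = a (ms n) i + X * t (n + 1) := fun i => exists_tail _
    choose t ht using this
    have hrec : ∀ n, ms n - ∑ i, t i n • g i = (X : PowerSeries k) • (ms (n + 1) - ∑ i, t i (n + 1) • g i) := by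
      intro n
      rw [smul_sub, Finset.smul_sum, sub_eq_iff_eq_add, sub_add_eq_add_sub, eq_sub_iff_add_eq]
      conv_lhs => rw [hms n]
      have : ∑ i, t i n • g i = ∑ i, a (ms n) i • g i + ∑ i, (X : PowerSeries k) • t i (n+1) • g i := by
        rw [← Finset.sum_add_distrib]
        refine Finset.sum_congr rfl fun i _ => ?_
        rw [smul_smul, ← add_smul, ← ht]
      rw [this]; abel
    refine ⟨fun i => t i 0, fun N => ⟨ms N - ∑ i, t i N • g i, ?_⟩⟩
    show ms 0 - _ = _
    induction N with
    | zero => simp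
    | succ N ih => rw [ih, hrec N, smul_smul, pow_succ]
  · intro c hc
    funext i
    exact hzero _ fun N => key N Finset.univ c (hc N) i (Finset.mem_univ i)

end PS

section Contr
open PowerSeries Pointwise

def PP (R : Type*) {M : Type*} [CommRing R] [AddCommGroup M] [Module R M] (Θ : M →+ M) (W : Set M)
    (n : ℕ) : Submodule R M :=
  Submodule.span R {y | ∃ i < n, ∃ w ∈ W, y = Θ^[i] w}

/-- The image of a submodule under a semilinear map. -/
def ImT {R M : Type*} [CommRing R] [AddCommGroup M] [Module R M] (α : R ≃+* R) (Θ : M →+ M)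
    (hΘ : ∀ (r : R) m, Θ (r • m) = α r • Θ m) (N : Submodule R M) : Submodule R M where
  carrier := {y | ∃ x ∈ N, Θ x = y}
  zero_mem' := ⟨0, N.zero_mem, map_zero Θ⟩
  add_mem' := by
    rintro _ _ ⟨x, hx, rfl⟩ ⟨y, hy, rfl⟩
    exact ⟨x + y, N.add_mem hx hy, map_add _ _ _⟩
  smul_mem' := by
    rintro r _ ⟨x, hx, rfl⟩
    exact ⟨α.symm r • x, N.smul_mem _ hx, by rw [hΘ, RingEquiv.apply_symm_apply]⟩

theorem ImT_mono {R M : Type*} [CommRing R] [AddCommGroup M] [Module R M] (α : R ≃+* R) (Θ : M →+ M)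
    (hΘ : ∀ (r : R) m, Θ (r • m) = α r • Θ m) {N N' : Submodule R M} (h : N ≤ N') :
    ImT α Θ hΘ N ≤ ImT α Θ hΘ N' := fun _ ⟨x, hx, e⟩ => ⟨x, h hx, e⟩

theorem PP_mono {R M : Type*} [CommRing R] [AddCommGroup M] [Module R M] (Θ : M →+ M) (W : Set M)
    {m n : ℕ} (h : m ≤ n) : PP R Θ W m ≤ PP R Θ W n :=
  Submodule.span_mono fun _ ⟨i, hi, w⟩ => ⟨i, lt_of_lt_of_le hi h, w⟩

theorem PP_fg {R M : Type*} [CommRing R] [AddCommGroup M] [Module R M] (Θ : M →+ M) (W : Set M)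
    (hW : W.Finite) (n : ℕ) : (PP R Θ W n).FG := by
  refine Submodule.fg_span ?_
  have : {y | ∃ i < n, ∃ w ∈ W, y = Θ^[i] w} = Set.image2 (fun i w => Θ^[i] w) (Set.Iio n) W := by
    ext y
    simp only [Set.mem_ofPred_eq, Set.mem_image2, Set.mem_Iio, eq_comm]
  rw [this]
  exact (Set.finite_Iio n).image2 _ hW

theorem PP_zero {R M : Type*} [CommRing R] [AddCommGroup M] [Module R M] (Θ : M →+ M) (W : Set M) :
    PP R Θ W 0 = ⊥ := by
  rw [PP, Submodule.span_eq_bot]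
  rintro x ⟨i, hi, _⟩
  omega

/-- `PP (j+1) ≤ P ⊔ Θ(PP j)`. -/
theorem PP_succ_le {R M : Type*} [CommRing R] [AddCommGroup M] [Module R M] (α : R ≃+* R)
    (Θ : M →+ M) (hΘ : ∀ (r : R) m, Θ (r • m) = α r • Θ m) (W : Set M) (j : ℕ) :
    PP R Θ W (j + 1) ≤ Submodule.span R W ⊔ ImT α Θ hΘ (PP R Θ W j) := by
  refine Submodule.span_le.mpr ?_
  rintro y ⟨i, hi, w, hw, rfl⟩
  cases i with
  | zero => exact Submodule.mem_sup_left (Submodule.subset_span hw)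
  | succ i =>
    refine Submodule.mem_sup_right ⟨Θ^[i] w, Submodule.subset_span ⟨i, by omega, w, hw, rfl⟩, ?_⟩
    rw [Function.iterate_succ_apply']

theorem ImT_PP_le {R M : Type*} [CommRing R] [AddCommGroup M] [Module R M] (α : R ≃+* R)
    (Θ : M →+ M) (hΘ : ∀ (r : R) m, Θ (r • m) = α r • Θ m) (W : Set M) (j : ℕ) (x : M)
    (hx : x ∈ PP R Θ W j) : Θ x ∈ PP R Θ W (j + 1) := by
  induction hx using Submodule.span_induction with
  | mem x h =>
    obtain ⟨i, hi, w, hw, rfl⟩ := h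
    exact Submodule.subset_span ⟨i + 1, by omega, w, hw, by rw [Function.iterate_succ_apply']⟩
  | zero => rw [map_zero]; exact Submodule.zero_mem _
  | add x y _ _ hx hy => rw [map_add]; exact Submodule.add_mem _ hx hy
  | smul r x _ hx => rw [hΘ]; exact Submodule.smul_mem _ _ hx

theorem solve_step {R M ι : Type*} [CommRing R] [AddCommGroup M] [Module R M] [Fintype ι]
    (Θ : M →+ M) (x : R) (A : ι → ι → R) (Q : Submodule R M) (Y : ℕ → Submodule R M)
    (hY0 : ∀ y ∈ Y 0, ∃ q ∈ Q, y = x • q) (N : ℕ) (hYQ : ∀ j ≤ N, Y j ≤ Q)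
    (hY : ∀ j < N, ∀ y ∈ Y (j + 1), ∃ z ∈ Y j, Θ z = y) (v : R) (w : R) (hvw : v * w = 1) :
    ∀ j ≤ N, ∀ e : ι → M, (∀ i, e i ∈ Y j) → ∃ h e' : ι → M, ∀ i, h i ∈ Q ∧ e' i ∈ Q ∧
      e i = ∑ l, A l i • h l - v • Θ (h i) + x • e' i := by
  intro j
  induction j with
  | zero =>
    intro _ e he
    choose e' h1 h2 using fun i => hY0 _ (he i)
    exact ⟨fun _ => 0, e', fun i => ⟨Q.zero_mem, h1 i, by simpa using h2 i⟩⟩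
  | succ j ih =>
    intro hj e he
    choose δ h1 h2 using fun i => hY j hj (-(w • e i)) ((Y (j + 1)).neg_mem ((Y (j+1)).smul_mem _ (he i)))
    obtain ⟨h, e', H⟩ := ih (by omega) (fun i => ∑ l, A l i • δ l)
      (fun i => Submodule.sum_mem _ fun l _ => Submodule.smul_mem _ _ (h1 l))
    refine ⟨fun i => δ i - h i, fun i => - e' i, fun i => ⟨Q.sub_mem (hYQ j (by omega) (h1 i)) (H i).1,
      Q.neg_mem (H i).2.1, ?_⟩⟩
    have h3 := (H i).2.2
    simp only [smul_sub, Finset.sum_sub_distrib, map_sub, h2, smul_neg, smul_smul, hvw, one_smul]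
    rw [h3]
    abel

theorem solve {k M ι : Type*} [Field k] [AddCommGroup M] [Module (PowerSeries k) M] [Fintype ι]
    (α : PowerSeries k ≃+* PowerSeries k) (u : (PowerSeries k)ˣ) (hu : α X = (u : PowerSeries k) * X)
    (Θ : M →+ M) (hΘ : ∀ (r : PowerSeries k) m, Θ (r • m) = α r • Θ m)
    (W : Set M) (hWf : W.Finite)
    (hW : ∀ w ∈ W, ∃ N, ∃ y ∈ PP (PowerSeries k) Θ W N, w = (X : PowerSeries k) • y)
    (A : ι → ι → PowerSeries k) (d : ι → M) (hd : ∀ i, d i ∈ W) :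
    ∃ (h : ι → M) (N : ℕ), ∀ i, h i ∈ PP (PowerSeries k) Θ W N ∧
      Θ (h i) + d i = ∑ l, A l i • h l := by
  classical
  let R := PowerSeries k
  -- uniform bound
  have hN : ∃ N, ∀ w ∈ W, ∃ y ∈ PP R Θ W (N + 2), w = (X : R) • y := by
    choose! N y hy hwy using hW
    obtain ⟨B, hB⟩ := (hWf.image N).bddAbove
    refine ⟨B, fun w hw => ⟨y w, PP_mono Θ W ?_ (hy w hw), hwy w hw⟩⟩
    exact (hB ⟨w, hw, rfl⟩).trans (by omega)
  obtain ⟨N, hN⟩ := hN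
  let Q := PP R Θ W (N + 1)
  let P := Submodule.span R W
  let XQ : Submodule R M := (X : R) • Q
  have hmemXQ : ∀ y, y ∈ XQ ↔ ∃ q ∈ Q, (X : R) • q = y := fun y =>
    Submodule.mem_smul_pointwise_iff_exists y _ _
  have hXQ : XQ ≤ Q := by
    intro y hy
    obtain ⟨q, hq, rfl⟩ := (hmemXQ y).mp hy
    exact Q.smul_mem _ hq
  -- X Θ(q) ∈ Θ (X Q)
  have hX1 : ∀ q ∈ Q, (X : R) • Θ q ∈ ImT α Θ hΘ XQ := by
    intro q hq
    refine ⟨(X : R) • α.symm (↑u⁻¹ : R) • q, (hmemXQ _).mpr ⟨_, Q.smul_mem _ hq, rfl⟩, ?_⟩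
    rw [hΘ, hΘ, hu, smul_smul, RingEquiv.apply_symm_apply, mul_right_comm, Units.mul_inv, one_mul]
  have hP : P ≤ ImT α Θ hΘ XQ := by
    refine Submodule.le_of_le_smul_of_le_jacobson_bot (I := Ideal.span {(X : R)})
      (Submodule.fg_span hWf) span_X_le ?_
    refine Submodule.span_le.mpr fun w hw => ?_
    obtain ⟨y, hy, rfl⟩ := hN w hw
    obtain ⟨p, hp, _, ⟨q, hq, rfl⟩, rfl⟩ := Submodule.mem_sup.mp (PP_succ_le α Θ hΘ W (N + 1) hy)
    rw [smul_add]
    exact Submodule.add_mem _ (Submodule.mem_sup_right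
      (Submodule.smul_mem_smul (Ideal.mem_span_singleton_self _) hp))
      (Submodule.mem_sup_left (hX1 q hq))
  have hQ : Q ≤ ImT α Θ hΘ Q := by
    refine (PP_succ_le α Θ hΘ W N).trans (sup_le (hP.trans (ImT_mono α Θ hΘ hXQ)) ?_)
    exact ImT_mono α Θ hΘ (PP_mono Θ W (by omega))
  let Y : ℕ → Submodule R M := fun j => PP R Θ W j ⊔ XQ
  have hYs : ∀ j, Y (j + 1) ≤ ImT α Θ hΘ (Y j) := by
    intro j
    refine sup_le ((PP_succ_le α Θ hΘ W j).trans (sup_le (hP.trans (ImT_mono α Θ hΘ le_sup_right))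
      (ImT_mono α Θ hΘ le_sup_left))) ?_
    intro y hy
    obtain ⟨q, hq, rfl⟩ := (hmemXQ y).mp hy
    obtain ⟨q', hq', rfl⟩ := hQ hq
    exact ImT_mono α Θ hΘ le_sup_right (hX1 q' hq')
  have step : ∀ (v : Rˣ) (e : ι → M), (∀ i, e i ∈ Q) → ∃ h e' : ι → M, ∀ i, h i ∈ Q ∧ e' i ∈ Q ∧
      e i = ∑ l, A l i • h l - (v : R) • Θ (h i) + (X : R) • e' i := by
    intro v e he
    refine solve_step Θ (X : R) A Q Y ?_ (N + 1) ?_ (fun j _ y hy => hYs j hy) v (↑v⁻¹ : R)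
      (Units.mul_inv v) (N + 1) le_rfl e (fun i => Submodule.mem_sup_left (he i))
    · intro y hy
      simp only [Y, PP_zero, bot_sup_eq] at hy
      obtain ⟨q, hq, h⟩ := (hmemXQ y).mp hy
      exact ⟨q, hq, h.symm⟩
    · intro j hj
      exact sup_le (PP_mono Θ W hj) hXQ
  choose! H E hHE using step
  have hdQ : ∀ i, d i ∈ Q := fun i => Submodule.subset_span ⟨0, by omega, d i, hd i, rfl⟩
  let e : ℕ → ι → M := fun n => Nat.rec d (fun n e => E (u ^ n) e) n
  have e0 : e 0 = d := rfl
  have es : ∀ n, e (n + 1) = E (u ^ n) (e n) := fun n => rfl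
  have heQ : ∀ n i, e n i ∈ Q := by
    intro n
    induction n with
    | zero => exact hdQ
    | succ n ih => intro i; rw [es]; exact (hHE _ _ ih i).2.1
  let h : ℕ → ι → M := fun n => H (u ^ n) (e n)
  have hhQ : ∀ n i, h n i ∈ Q := fun n i => (hHE _ _ (heQ n) i).1
  have hrec : ∀ n i, e n i = ∑ l, A l i • h n l - ((u ^ n : Rˣ) : R) • Θ (h n i) + (X : R) • e (n + 1) i :=
    fun n i => (hHE _ _ (heQ n) i).2.2
  have hQf : Q.FG := PP_fg Θ W hWf _
  choose t htQ ht using fun i => exists_tail_mod Q hQf (fun n => h n i) (fun n => hhQ n i)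
  refine ⟨fun i => t i 0, N + 1, fun i => ⟨htQ i 0, ?_⟩⟩
  let err : ℕ → M := fun n => e n i - (∑ l, A l i • t l n - ((u ^ n : Rˣ) : R) • Θ (t i n))
  have herr : err 0 = 0 := by
    refine krull_seq (PP R Θ W (N + 2)) (PP_fg Θ W hWf _) err ?_ ?_
    · intro n
      have hle : Q ≤ PP R Θ W (N + 2) := PP_mono Θ W (by omega)
      refine Submodule.sub_mem _ (hle (heQ n i)) (Submodule.sub_mem _ ?_ ?_)
      · exact Submodule.sum_mem _ fun l _ => Submodule.smul_mem _ _ (hle (htQ l n))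
      · exact Submodule.smul_mem _ _ (ImT_PP_le α Θ hΘ W _ _ (htQ i n))
    · intro n
      have h1 : ∑ l, A l i • t l n = ∑ l, A l i • h n l + (X : R) • ∑ l, A l i • t l (n + 1) := by
        rw [Finset.smul_sum, ← Finset.sum_add_distrib]
        refine Finset.sum_congr rfl fun l _ => ?_
        rw [smul_comm (X : R), ← smul_add, ← ht]
      have h2 : ((u ^ n : Rˣ) : R) • Θ (t i n) = ((u ^ n : Rˣ) : R) • Θ (h n i) +
          (X : R) • ((u ^ (n + 1) : Rˣ) : R) • Θ (t i (n + 1)) := by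
        rw [ht i n, map_add, hΘ, hu, smul_add, smul_smul, smul_smul]
        congr 2
        push_cast
        ring
      show e n i - (∑ l, A l i • t l n - ((u ^ n : Rˣ) : R) • Θ (t i n)) = (X : R) •
        (e (n+1) i - (∑ l, A l i • t l (n+1) - ((u ^ (n+1) : Rˣ) : R) • Θ (t i (n+1))))
      rw [h1, h2, hrec n i, smul_sub, smul_sub]
      abel
  have h3 : d i - (∑ l, A l i • t l 0 - Θ (t i 0)) = 0 := by simpa [err, e0] using herr
  rw [sub_eq_zero] at h3
  rw [h3]; abel

end Contr

section Skew
open PowerSeries Pointwise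

structure SkewD {R S : Type*} [CommRing R] [Ring S] (α : R ≃+* R) (φ : R →+* S) (θ : S) : Prop where
  comm : ∀ r, θ * φ r = φ (α r) * θ
  surj : ∀ s : S, ∃ (N : ℕ) (c : ℕ → R), s = ∑ i ∈ Finset.range N, φ (c i) * θ ^ i

theorem SkewD.induct {R S : Type*} [CommRing R] [Ring S] {α : R ≃+* R} {φ : R →+* S} {θ : S}
    (H : SkewD α φ θ) (p : S → Prop) (hadd : ∀ a b, p a → p b → p (a + b))
    (hmul : ∀ a b, p a → p b → p (a * b)) (hφ : ∀ r, p (φ r)) (hθ : p θ) (s : S) : p s := by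
  obtain ⟨N, c, rfl⟩ := H.surj s
  have h0 : p 0 := by simpa using hφ 0
  have h1 : p 1 := by simpa using hφ 1
  have hp : ∀ i, p (θ ^ i) := by
    intro i
    induction i with
    | zero => simpa using h1
    | succ i ih => rw [pow_succ]; exact hmul _ _ ih hθ
  induction N with
  | zero => simpa using h0
  | succ N ih => rw [Finset.sum_range_succ]; exact hadd _ _ ih (hmul _ _ (hφ _) (hp _))

theorem SkewD.comm_pow {R S : Type*} [CommRing R] [Ring S] {α : R ≃+* R} {φ : R →+* S} {θ : S}
    (H : SkewD α φ θ) (n : ℕ) (r : R) : θ ^ n * φ r = φ (α^[n] r) * θ ^ n := by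
  induction n with
  | zero => simp
  | succ n ih =>
    rw [pow_succ', mul_assoc, ih, ← mul_assoc, H.comm, mul_assoc, Function.iterate_succ_apply']

theorem SkewD.noeth {R S : Type*} [CommRing R] [IsNoetherianRing R] [Ring S] {α : R ≃+* R}
    {φ : R →+* S} {θ : S} (H : SkewD α φ θ) : IsNoetherianRing S := by
  let _ : Module R S := Module.compHom S φ
  have hsm : ∀ (r : R) (s : S), r • s = φ r * s := fun _ _ => rfl
  let T : ℕ → Submodule R S := fun n => Submodule.span R ((fun i => θ ^ i) '' Set.Iio n)
  have hTf : ∀ n, (T n).FG := fun n => Submodule.fg_span ((Set.finite_Iio n).image _)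
  have hTmono : ∀ {m n}, m ≤ n → T m ≤ T n := fun h =>
    Submodule.span_mono (Set.image_mono (Set.Iio_subset_Iio h))
  have hpow : ∀ {i n}, i < n → θ ^ i ∈ T n := fun h => Submodule.subset_span ⟨_, h, rfl⟩
  have hθT : ∀ n x, x ∈ T n → θ * x ∈ T (n + 1) := by
    intro n x hx
    induction hx using Submodule.span_induction with
    | mem x h =>
      obtain ⟨i, hi, rfl⟩ := h
      show θ * θ ^ i ∈ _
      rw [← pow_succ']; exact hpow (Nat.succ_lt_succ hi)
    | zero => rw [mul_zero]; exact Submodule.zero_mem _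
    | add x y _ _ hx hy => rw [mul_add]; exact Submodule.add_mem _ hx hy
    | smul r x _ hx =>
      rw [hsm, ← mul_assoc, H.comm, mul_assoc]; exact Submodule.smul_mem _ (α r) hx
  have hθnT : ∀ j n x, x ∈ T n → θ ^ j * x ∈ T (n + j) := by
    intro j
    induction j with
    | zero => intro n x hx; simpa using hx
    | succ j ih => intro n x hx; rw [pow_succ', mul_assoc]; exact hθT _ _ (ih n x hx)
  have hTall : ∀ s, ∃ n, s ∈ T n := by
    intro s
    obtain ⟨N, c, rfl⟩ := H.surj s
    exact ⟨N, Submodule.sum_mem _ fun i hi => Submodule.smul_mem _ (c i) (hpow (Finset.mem_range.mp hi))⟩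
  have hTsucc : ∀ n s, s ∈ T (n + 1) → ∃ c, s - θ ^ n * φ c ∈ T n := by
    intro n s hs
    induction hs using Submodule.span_induction with
    | mem x h =>
      obtain ⟨i, hi, rfl⟩ := h
      rcases Nat.lt_succ_iff_lt_or_eq.mp hi with h | rfl
      · exact ⟨0, by simpa using hpow h⟩
      · exact ⟨1, by simp⟩
    | zero => exact ⟨0, by simp⟩
    | add x y _ _ hx hy =>
      obtain ⟨c, hc⟩ := hx
      obtain ⟨d, hd⟩ := hy
      refine ⟨c + d, ?_⟩
      have := Submodule.add_mem _ hc hd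
      rw [map_add, mul_add]
      rwa [sub_add_sub_comm] at this
    | smul r x _ hx =>
      obtain ⟨c, hc⟩ := hx
      refine ⟨α.symm^[n] r * c, ?_⟩
      have := Submodule.smul_mem _ r hc
      rw [smul_sub] at this
      have e : r • (θ ^ n * φ c) = θ ^ n * φ (α.symm^[n] r * c) := by
        have e2 : α^[n] (α.symm^[n] r) = r := Function.LeftInverse.iterate α.right_inv n r
        rw [map_mul, ← mul_assoc, H.comm_pow n (α.symm^[n] r), e2, hsm, mul_assoc]
      rwa [e] at this
  refine ⟨fun I => ?_⟩
  let J : ℕ → Ideal R := fun n =>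
    { carrier := {c | ∃ s ∈ I, s - θ ^ n * φ c ∈ T n}
      zero_mem' := ⟨0, I.zero_mem, by simp⟩
      add_mem' := by
        rintro c d ⟨s, hs, hc⟩ ⟨t, ht, hd⟩
        refine ⟨s + t, I.add_mem hs ht, ?_⟩
        have := Submodule.add_mem _ hc hd
        rw [map_add, mul_add]
        rwa [sub_add_sub_comm] at this
      smul_mem' := by
        rintro r c ⟨s, hs, hc⟩
        refine ⟨φ (α^[n] r) * s, I.smul_mem _ hs, ?_⟩
        have := Submodule.smul_mem _ (α^[n] r) hc
        rwa [hsm, mul_sub, ← mul_assoc (φ _) (θ ^ n), ← H.comm_pow, mul_assoc (θ ^ n), ← map_mul] at this }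
  have hJ : Monotone J := by
    refine monotone_nat_of_le_succ fun n => ?_
    rintro c ⟨s, hs, hc⟩
    refine ⟨θ * s, I.smul_mem θ hs, ?_⟩
    have := hθT _ _ hc
    rwa [mul_sub, ← mul_assoc, ← pow_succ'] at this
  obtain ⟨n0, hn0⟩ := monotone_stabilizes_iff_noetherian.mpr (inferInstance : IsNoetherian R R) ⟨J, hJ⟩
  have hn0 : ∀ m, n0 ≤ m → J n0 = J m := hn0
  let IR : Submodule R S :=
    { carrier := I
      zero_mem' := I.zero_mem
      add_mem' := I.add_mem
      smul_mem' := fun r x hx => I.smul_mem (φ r) hx }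
  have hfin : (IR ⊓ T (n0 + 1)).FG := by
    have : Module.Finite R (T (n0 + 1)) := Module.Finite.iff_fg.mpr (hTf _)
    exact (isNoetherian_submodule (N := T (n0 + 1))).mp inferInstance _ inf_le_right
  obtain ⟨F, hF⟩ := hfin
  refine ⟨F, le_antisymm (Submodule.span_le.mpr fun x hx => ?_) ?_⟩
  · have : x ∈ IR ⊓ T (n0 + 1) := hF ▸ Submodule.subset_span hx
    exact this.1
  have hbase : ∀ x, x ∈ I → x ∈ T (n0 + 1) → x ∈ Submodule.span S (F : Set S) := by
    intro x hxI hxT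
    have : x ∈ Submodule.span R (F : Set S) := by rw [hF]; exact ⟨hxI, hxT⟩
    induction this using Submodule.span_induction with
    | mem x h => exact Submodule.subset_span h
    | zero => exact Submodule.zero_mem _
    | add x y hx hy h1 h2 =>
      rw [hF] at hx hy
      exact Submodule.add_mem _ (h1 hx.1 hx.2) (h2 hy.1 hy.2)
    | smul r x hx h1 =>
      rw [hF] at hx
      exact Submodule.smul_mem _ (φ r) (h1 hx.1 hx.2)
  have hind : ∀ j x, x ∈ I → x ∈ T (n0 + 1 + j) → x ∈ Submodule.span S (F : Set S) := by
    intro j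
    induction j with
    | zero => exact hbase
    | succ j ih =>
      intro x hxI hxT
      obtain ⟨c, hc⟩ := hTsucc (n0 + 1 + j) x hxT
      have hcJ : c ∈ J (n0 + 1 + j) := ⟨x, hxI, hc⟩
      rw [← hn0 _ (by omega)] at hcJ
      obtain ⟨t, htI, ht⟩ := hcJ
      have htT : t ∈ T (n0 + 1) := by
        have h1 : θ ^ n0 * φ c ∈ T (n0 + 1) := by
          rw [H.comm_pow]; exact Submodule.smul_mem _ _ (hpow (Nat.lt_succ_self _))
        have := Submodule.add_mem _ (hTmono (Nat.le_succ n0) ht) h1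
        rwa [sub_add_cancel] at this
      have h2 : x - θ ^ (j + 1) * t ∈ T (n0 + 1 + j) := by
        have h3 := hθnT (j + 1) _ _ ht
        rw [mul_sub, ← mul_assoc, ← pow_add, show j + 1 + n0 = n0 + 1 + j by omega,
          show n0 + (j + 1) = n0 + 1 + j by omega] at h3
        have := Submodule.sub_mem _ hc h3
        rwa [sub_sub_sub_cancel_right] at this
      have h4 := ih _ (I.sub_mem hxI (I.smul_mem (θ ^ (j + 1)) htI)) h2
      have := Submodule.add_mem _ h4 (Submodule.smul_mem _ (θ ^ (j + 1)) (hbase t htI htT))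
      rwa [smul_eq_mul, sub_add_cancel] at this
  intro x hx
  obtain ⟨n, hn⟩ := hTall x
  exact hind n x hx (hTmono (by omega) hn)

/-- normality of `X`. -/
theorem SkewD.normal1 {k S : Type*} [Field k] [Ring S] {α : PowerSeries k ≃+* PowerSeries k}
    {φ : PowerSeries k →+* S} {θ : S} (H : SkewD α φ θ) (u : (PowerSeries k)ˣ)
    (hu : α X = (u : PowerSeries k) * X) (n : ℕ) (s : S) : ∃ s', s * φ X ^ n = φ X ^ n * s' := by
  have h1 : ∀ s, ∃ s', s * φ X = φ X * s' := by
    refine H.induct _ ?_ ?_ ?_ ?_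
    · rintro a b ⟨a', ha⟩ ⟨b', hb⟩; exact ⟨a' + b', by rw [add_mul, mul_add, ha, hb]⟩
    · rintro a b ⟨a', ha⟩ ⟨b', hb⟩
      exact ⟨a' * b', by rw [mul_assoc, hb, ← mul_assoc, ha, mul_assoc]⟩
    · intro r; exact ⟨φ r, by rw [← map_mul, mul_comm, map_mul]⟩
    · exact ⟨φ u * θ, by rw [H.comm, hu, ← mul_assoc, ← map_mul, mul_comm]⟩
  induction n generalizing s with
  | zero => exact ⟨s, by simp⟩
  | succ n ih =>
    obtain ⟨s', hs⟩ := ih s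
    obtain ⟨s'', hs'⟩ := h1 s'
    exact ⟨s'', by rw [pow_succ, ← mul_assoc, hs, mul_assoc, hs', ← mul_assoc]⟩

theorem SkewD.normal2 {k S : Type*} [Field k] [Ring S] {α : PowerSeries k ≃+* PowerSeries k}
    {φ : PowerSeries k →+* S} {θ : S} (H : SkewD α φ θ) (u : (PowerSeries k)ˣ)
    (hu : α X = (u : PowerSeries k) * X) (n : ℕ) (s : S) : ∃ s', φ X ^ n * s = s' * φ X ^ n := by
  have h1 : ∀ s, ∃ s', φ X * s = s' * φ X := by
    refine H.induct _ ?_ ?_ ?_ ?_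
    · rintro a b ⟨a', ha⟩ ⟨b', hb⟩; exact ⟨a' + b', by rw [add_mul, mul_add, ha, hb]⟩
    · rintro a b ⟨a', ha⟩ ⟨b', hb⟩
      exact ⟨a' * b', by rw [← mul_assoc, ha, mul_assoc, hb, mul_assoc]⟩
    · intro r; exact ⟨φ r, by rw [← map_mul, mul_comm, map_mul]⟩
    · refine ⟨φ (↑u⁻¹ : PowerSeries k) * θ, ?_⟩
      rw [mul_assoc, H.comm, hu, ← mul_assoc, ← map_mul, ← mul_assoc, Units.inv_mul, one_mul]
  induction n generalizing s with
  | zero => exact ⟨s, by simp⟩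
  | succ n ih =>
    obtain ⟨s', hs⟩ := h1 s
    obtain ⟨s'', hs'⟩ := ih s'
    exact ⟨s'', by rw [pow_succ, mul_assoc, hs, ← mul_assoc, hs', mul_assoc]⟩

def kerX {k S M : Type*} [Field k] [Ring S] [AddCommGroup M] [Module S M]
    {α : PowerSeries k ≃+* PowerSeries k}
    {φ : PowerSeries k →+* S} {θ : S} (H : SkewD α φ θ) (u : (PowerSeries k)ˣ)
    (hu : α X = (u : PowerSeries k) * X) (n : ℕ) : Submodule S M where
  carrier := {m | φ X ^ n • m = 0}
  zero_mem' := smul_zero _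
  add_mem' := by
    intro a b (ha : _ = _) (hb : _ = _)
    show _ = _
    rw [smul_add, ha, hb, add_zero]
  smul_mem' := by
    intro s m (hm : _ = _)
    obtain ⟨s', hs⟩ := H.normal2 u hu n s
    show _ = _
    rw [smul_smul, hs, mul_smul, hm, smul_zero]

def rangeX {k S M : Type*} [Field k] [Ring S] [AddCommGroup M] [Module S M]
    {α : PowerSeries k ≃+* PowerSeries k}
    {φ : PowerSeries k →+* S} {θ : S} (H : SkewD α φ θ) (u : (PowerSeries k)ˣ)
    (hu : α X = (u : PowerSeries k) * X) (n : ℕ) : Submodule S M where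
  carrier := {m | ∃ y, m = φ X ^ n • y}
  zero_mem' := ⟨0, (smul_zero _).symm⟩
  add_mem' := by
    rintro _ _ ⟨a, rfl⟩ ⟨b, rfl⟩
    exact ⟨a + b, (smul_add _ _ _).symm⟩
  smul_mem' := by
    rintro s _ ⟨m, rfl⟩
    obtain ⟨s', hs⟩ := H.normal1 u hu n s
    exact ⟨s' • m, by rw [smul_smul, hs, mul_smul]⟩

end Skew

section Core
open PowerSeries Pointwise

/-- the additive map given by `θ`. -/
def Th {S : Type*} (M : Type*) [Ring S] [AddCommGroup M] [Module S M] (θ : S) : M →+ M :=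
  DistribSMul.toAddMonoidHom M θ

theorem Th_apply {S M : Type*} [Ring S] [AddCommGroup M] [Module S M] (θ : S) (m : M) :
    Th M θ m = θ • m := rfl

theorem Th_iter {S M : Type*} [Ring S] [AddCommGroup M] [Module S M] (θ : S) (n : ℕ) (m : M) :
    (Th M θ)^[n] m = θ ^ n • m := smul_iterate_apply θ n m

theorem mono_algc {D S M : Type*} [CommRing D] [IsDomain D] [Ring S] [AddCommGroup M] [Module S M]
    [Module D M] (θ : S) (α : D ≃+* D) (hΘ : ∀ (r : D) (m : M), Th M θ (r • m) = α r • Th M θ m)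
    (hact : ∀ (s : S) (m : M), ∃ (N : ℕ) (c : ℕ → D),
      s • m = ∑ i ∈ Finset.range N, c i • (Th M θ)^[i] m)
    (U : Submodule S M) (hU : ∀ W : Submodule S M, W ≠ ⊥ → U ≤ W) (v : M) (hv : v ∈ U)
    (hv0 : v ≠ 0) (hva : Algc D (Th M θ) v) (m : M) : Algc D (Th M θ) m := by
  by_cases hm : m = 0
  · rw [hm]; exact algc_zero _
  have h1 : v ∈ Submodule.span S {m} := hU _ (by simpa using hm) hv
  obtain ⟨s, hs⟩ := Submodule.mem_span_singleton.mp h1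
  obtain ⟨N, c, hc⟩ := hact s m
  refine algc_step α (Th M θ) hΘ m c N ?_ ?_
  · by_contra! h
    apply hv0
    rw [← hs, hc]
    exact Finset.sum_eq_zero fun i hi => by rw [h i (Finset.mem_range.mp hi), zero_smul]
  · rw [← hc, hs]; exact hva

theorem algc_sat {D S M : Type*} [CommRing D] [IsDomain D] [Ring S] [AddCommGroup M] [Module S M]
    [Module D M] (θ : S)
    (hact : ∀ (s : S) (m : M), ∃ (N : ℕ) (c : ℕ → D),
      s • m = ∑ i ∈ Finset.range N, c i • (Th M θ)^[i] m)
    (hfin : Module.Finite S M) (h : ∀ m : M, Algc D (Th M θ) m) :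
    ∃ B : Submodule D M, B.FG ∧ ∀ x, x ∈ satur B := by
  obtain ⟨G, hG⟩ := hfin.fg_top
  choose B hB hBm using h
  refine ⟨G.sup B, Submodule.fg_finset_sup G B fun i _ => hB i, fun x => ?_⟩
  have hx : x ∈ Submodule.span S (G : Set M) := by rw [hG]; trivial
  induction hx using Submodule.closure_induction with
  | zero => exact Submodule.zero_mem _
  | add x y _ _ h1 h2 => exact Submodule.add_mem _ h1 h2
  | smul_mem s x hx =>
    obtain ⟨N, c, hc⟩ := hact s x
    rw [hc]
    exact Submodule.sum_mem _ fun i _ => Submodule.smul_mem _ _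
      (satur_mono (Finset.le_sup (f := B) hx) (hBm x i))

variable {k S M : Type*} [Field k] [Ring S] [AddCommGroup M] [Module S M]
  {α : PowerSeries k ≃+* PowerSeries k} {φ : PowerSeries k →+* S} {θ : S}

theorem hΘ_of [Module (PowerSeries k) M] (H : SkewD α φ θ)
    (hc : ∀ (r : PowerSeries k) (m : M), r • m = φ r • m) (r : PowerSeries k) (m : M) :
    Th M θ (r • m) = α r • Th M θ m := by
  rw [Th_apply, Th_apply, hc, hc, smul_smul, H.comm, mul_smul]

theorem hact_of [Module (PowerSeries k) M] (H : SkewD α φ θ)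
    (hc : ∀ (r : PowerSeries k) (m : M), r • m = φ r • m) (s : S) (m : M) :
    ∃ (N : ℕ) (c : ℕ → PowerSeries k), s • m = ∑ i ∈ Finset.range N, c i • (Th M θ)^[i] m := by
  obtain ⟨N, c, rfl⟩ := H.surj s
  refine ⟨N, c, ?_⟩
  rw [Finset.sum_smul]
  exact Finset.sum_congr rfl fun i _ => by rw [Th_iter, hc, mul_smul]

theorem X_inj (H : SkewD α φ θ) (u : (PowerSeries k)ˣ)
    (hu : α X = (u : PowerSeries k) * X)
    (U : Submodule S M) (hU : ∀ W : Submodule S M, W ≠ ⊥ → U ≤ W)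
    (hxU : ∃ v ∈ U, φ X • v ≠ 0) (m : M) (hm : φ X • m = 0) : m = 0 := by
  by_contra h
  obtain ⟨v, hv, hv0⟩ := hxU
  have : (kerX H u hu 1 : Submodule S M) ≠ ⊥ := by
    intro h'
    have : m ∈ (kerX H u hu 1 : Submodule S M) := by
      show φ X ^ 1 • m = 0
      rwa [pow_one]
    rw [h'] at this
    exact h (by simpa using this)
  have h2 : φ X ^ 1 • v = 0 := hU _ this hv
  rw [pow_one] at h2
  exact hv0 h2

theorem core2_rank [Module (PowerSeries k) M] (H : SkewD α φ θ)
    (hc : ∀ (r : PowerSeries k) (m : M), r • m = φ r • m)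
    (u : (PowerSeries k)ˣ) (hu : α X = (u : PowerSeries k) * X) (hfin : Module.Finite S M)
    (U : Submodule S M) (hU : ∀ W : Submodule S M, W ≠ ⊥ → U ≤ W)
    (hxU : ∃ v ∈ U, φ X • v ≠ 0) : Module.rank (PowerSeries k) M < Cardinal.aleph0 := by
  have hΘ := hΘ_of (M := M) H hc
  have hact := hact_of (M := M) H hc
  obtain ⟨v, hv, hXv⟩ := hxU
  have hv0 : v ≠ 0 := fun h => hXv (by rw [h, smul_zero])
  have hva : Algc (PowerSeries k) (Th M θ) v := by
    have h1 : v ∈ Submodule.span S {φ X • v} := hU _ (by simpa using hXv) hv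
    obtain ⟨s, hs⟩ := Submodule.mem_span_singleton.mp h1
    obtain ⟨N, c, hcs⟩ := hact s (φ X • v)
    rw [hs] at hcs
    let c' : ℕ → PowerSeries k := fun i => (if i < N then c i * α^[i] X else 0) - (if i = 0 then 1 else 0)
    refine algc_step α (Th M θ) hΘ v c' (N + 1) ⟨0, by omega, ?_⟩ ?_
    · intro h
      have := congrArg constantCoeff h
      by_cases hN : 0 < N <;> simp [c', hN] at this
    · have h2 : ∑ i ∈ Finset.range (N + 1), c' i • (Th M θ)^[i] v = 0 := by
        simp only [c', sub_smul, Finset.sum_sub_distrib]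
        rw [sub_eq_zero, Finset.sum_range_succ]
        simp only [lt_irrefl, if_false, zero_smul, add_zero, ite_smul, one_smul]
        rw [Finset.sum_ite_eq' ]
        simp only [Finset.mem_range, Nat.succ_pos, if_true, Function.iterate_zero, id]
        conv_rhs => rw [hcs]
        refine Finset.sum_congr rfl fun i hi => ?_
        rw [if_pos (Finset.mem_range.mp hi), ← hc, iter_smul α (Th M θ) hΘ, smul_smul]
      rw [h2]; exact algc_zero _
  obtain ⟨B, hB, hBs⟩ := algc_sat θ hact hfin (mono_algc θ α hΘ hact U hU v hv hv0 hva)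
  exact satur_rank B hB hBs

theorem core2_div [IsNoetherian S M] [Module (PowerSeries k) M] (H : SkewD α φ θ)
    (hc : ∀ (r : PowerSeries k) (m : M), r • m = φ r • m)
    (u : (PowerSeries k)ˣ) (hu : α X = (u : PowerSeries k) * X)
    (U : Submodule S M) (hU : ∀ W : Submodule S M, W ≠ ⊥ → U ≤ W)
    (hxU : ∃ v ∈ U, φ X • v ≠ 0) (m : M) : ∃ y, m = φ X • y := by
  have hΘ := hΘ_of (M := M) H hc
  have hact := hact_of (M := M) H hc
  have hinj := X_inj H u hu U hU hxU
  have hinj' : ∀ m : M, (X : PowerSeries k) • m = 0 → m = 0 := fun m hm => hinj m (by rwa [← hc])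
  have hrank := core2_rank H hc u hu inferInstance U hU hxU
  have hpc : ∀ (n : ℕ) (m : M), (X ^ n : PowerSeries k) • m = φ X ^ n • m := by
    intro n m; rw [hc, map_pow]
  obtain ⟨ι, _, g, hgen, hind⟩ := exists_gens hinj' hrank
  let M' : Submodule S M := ⨅ n, rangeX H u hu n
  have hM' : ∀ m, m ∈ M' ↔ ∀ N : ℕ, ∃ y, m = (X ^ N : PowerSeries k) • y := by
    intro m
    simp only [M', Submodule.mem_iInf, hpc]
    rfl
  have hUM' : U ≤ M' := by
    obtain ⟨v, hv, hXv⟩ := hxU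
    refine le_iInf fun n => hU _ fun h => ?_
    have h1 : φ X ^ n • v ∈ (rangeX H u hu n : Submodule S M) := ⟨v, rfl⟩
    rw [h, Submodule.mem_bot] at h1
    have h2 : ∀ n, φ X ^ n • v = 0 → v = 0 := by
      intro n
      induction n with
      | zero => intro h; simpa using h
      | succ n ih => intro h; rw [pow_succ', mul_smul] at h; exact ih (hinj _ h)
    exact hXv (by rw [h2 n h1, smul_zero])
  have hM'R : ∀ (r : PowerSeries k) x, x ∈ M' → r • x ∈ M' := by
    intro r x hx; rw [hc]; exact M'.smul_mem _ hx
  have hM'div : ∀ x ∈ M', ∃ y ∈ M', x = (X : PowerSeries k) • y := by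
    intro x hx
    rw [hM'] at hx
    obtain ⟨y, hy⟩ := hx 1
    rw [pow_one] at hy
    refine ⟨y, (hM' y).mpr fun N => ?_, hy⟩
    obtain ⟨z, hz⟩ := hx (N + 1)
    refine ⟨z, ?_⟩
    rw [← sub_eq_zero]
    apply hinj'
    rw [smul_sub, ← hy, hz, smul_smul, pow_succ', sub_self]
  obtain ⟨W0, hW0⟩ := IsNoetherian.noetherian M'
  choose cc hcc using fun j => hgen (Th M θ (g j))
  let d : ι → M := fun j => Th M θ (g j) - ∑ i, cc j i • g i
  have hd : ∀ j, d j ∈ M' := fun j => (hM' _).mpr (hcc j)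
  let W : Set M := (W0 : Set M) ∪ Set.range d
  have hWM' : ∀ w ∈ W, w ∈ M' := by
    rintro w (hw | ⟨j, rfl⟩)
    · rw [← hW0]; exact Submodule.subset_span hw
    · exact hd j
  have hPPall : ∀ y ∈ M', ∃ N, y ∈ PP (PowerSeries k) (Th M θ) W N := by
    intro y hy
    rw [← hW0] at hy
    induction hy using Submodule.closure_induction with
    | zero => exact ⟨0, Submodule.zero_mem _⟩
    | add x y _ _ h1 h2 =>
      obtain ⟨a, ha⟩ := h1
      obtain ⟨b, hb⟩ := h2
      exact ⟨max a b, Submodule.add_mem _ (PP_mono _ _ (le_max_left _ _) ha)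
        (PP_mono _ _ (le_max_right _ _) hb)⟩
    | smul_mem s x hx =>
      obtain ⟨N, c, hcs⟩ := hact s x
      refine ⟨N, ?_⟩
      rw [hcs]
      exact Submodule.sum_mem _ fun i hi => Submodule.smul_mem _ _
        (Submodule.subset_span ⟨i, Finset.mem_range.mp hi, x, Or.inl hx, rfl⟩)
  have hPPM' : ∀ N, ∀ y ∈ PP (PowerSeries k) (Th M θ) W N, y ∈ M' := by
    intro N y hy
    induction hy using Submodule.span_induction with
    | mem x h =>
      obtain ⟨i, _, w, hw, rfl⟩ := h
      rw [Th_iter]; exact M'.smul_mem _ (hWM' w hw)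
    | zero => exact M'.zero_mem
    | add x y _ _ hx hy => exact M'.add_mem hx hy
    | smul r x _ hx => exact hM'R r x hx
  obtain ⟨h, N, hh⟩ := solve α u hu (Th M θ) hΘ W (W0.finite_toSet.union (Set.finite_range d))
    (fun w hw => by
      obtain ⟨y, hy, e⟩ := hM'div w (hWM' w hw)
      obtain ⟨N, hN⟩ := hPPall y hy
      exact ⟨N, y, hN, e⟩) (fun l j => cc j l) d (fun j => Or.inr ⟨j, rfl⟩)
  have hhM' : ∀ j, h j ∈ M' := fun j => hPPM' N _ (hh j).1
  let g' : ι → M := fun j => g j + h j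
  have hg' : ∀ j, θ • g' j = ∑ l, cc j l • g' l := by
    intro j
    have h1 := (hh j).2
    have h2 : Th M θ (g j) = d j + ∑ i, cc j i • g i := by simp only [d]; abel
    rw [← Th_apply]
    simp only [g', map_add, smul_add, Finset.sum_add_distrib]
    rw [← h1, h2]; abel
  let LR : Submodule (PowerSeries k) M := Submodule.span _ (Set.range g')
  have hLθ : ∀ x ∈ LR, θ • x ∈ LR := by
    intro x hx
    induction hx using Submodule.span_induction with
    | mem x h =>
      obtain ⟨j, rfl⟩ := h
      rw [hg']
      exact Submodule.sum_mem _ fun l _ => Submodule.smul_mem _ _ (Submodule.subset_span ⟨l, rfl⟩)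
    | zero => rw [smul_zero]; exact LR.zero_mem
    | add x y _ _ hx hy => rw [smul_add]; exact LR.add_mem hx hy
    | smul r x _ hx =>
      rw [← Th_apply, hΘ]; exact LR.smul_mem _ hx
  let L : Submodule S M :=
    { carrier := LR
      zero_mem' := LR.zero_mem
      add_mem' := LR.add_mem
      smul_mem' := by
        intro s
        refine H.induct (fun s => ∀ {x}, x ∈ LR → s • x ∈ LR) ?_ ?_ ?_ ?_ s
        · intro a b ha hb x hx; rw [add_smul]; exact LR.add_mem (ha hx) (hb hx)
        · intro a b ha hb x hx; rw [mul_smul]; exact ha (hb hx)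
        · intro r x hx; rw [← hc]; exact LR.smul_mem _ hx
        · intro x hx; exact hLθ x hx }
  have hLbot : L = ⊥ := by
    by_contra hL
    obtain ⟨v, hv, hXv⟩ := hxU
    have hvL : v ∈ LR := hU L hL hv
    obtain ⟨c, hcv⟩ := (Submodule.mem_span_range_iff_exists_fun _).mp hvL
    have h1 : ∑ i, c i • g i ∈ M' := by
      have : ∑ i, c i • g i = v - ∑ i, c i • h i := by
        rw [← hcv]; simp only [g', smul_add, Finset.sum_add_distrib]; abel
      rw [this]
      exact M'.sub_mem (hUM' hv) (Submodule.sum_mem _ fun i _ => hM'R _ _ (hhM' i))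
    have h2 := hind c ((hM' _).mp h1)
    apply hXv
    rw [← hcv, h2]; simp
  have hempty : IsEmpty ι := by
    refine ⟨fun j => ?_⟩
    have h1 : g' j ∈ L := Submodule.subset_span ⟨j, rfl⟩
    rw [hLbot, Submodule.mem_bot] at h1
    have h2 : g j ∈ M' := by
      have : g j = - h j := eq_neg_of_add_eq_zero_left h1
      rw [this]; exact M'.neg_mem (hhM' j)
    classical
    have h3 := hind (Pi.single j 1) ((hM' _).mp (by
      have : ∑ i, (Pi.single j 1 : ι → PowerSeries k) i • g i = g j := by
        rw [Finset.sum_eq_single j] <;> simp +contextual [Pi.single_apply]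
      rwa [this]))
    have := congrFun h3 j
    simp at this
  obtain ⟨c, hcm⟩ := hgen m
  obtain ⟨y, hy⟩ := hcm 1
  refine ⟨y, ?_⟩
  rw [pow_one, hc] at hy
  simpa using hy

end Core

section Art
open PowerSeries Pointwise

variable {k S M : Type*} [Field k] [Ring S] [AddCommGroup M] [Module S M]
  {α : PowerSeries k ≃+* PowerSeries k} {φ : PowerSeries k →+* S} {θ : S}

/-- restriction of scalars of a submodule along a ring map. -/
def resS {A S M : Type*} [CommRing A] [Ring S] [AddCommGroup M] [Module S M] [Module A M]
    (ψ : A →+* S) (hc : ∀ (r : A) (m : M), r • m = ψ r • m) (N : Submodule S M) :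
    Submodule A M where
  carrier := N
  zero_mem' := N.zero_mem
  add_mem' := N.add_mem
  smul_mem' := by
    intro r x hx
    rw [hc]
    exact N.smul_mem _ hx

theorem artin_of_strict {S M : Type*} [Ring S] [AddCommGroup M] [Module S M]
    (f : Submodule S M → ℕ) (hf : ∀ N N', N < N' → f N < f N') : IsArtinian S M := by
  refine ⟨?_⟩
  exact Subrelation.wf (fun {a b} h => hf a b h) (InvImage.wf f Nat.lt_wfRel.wf)

theorem map_sub_ne_bot {S M : Type*} [Ring S] [AddCommGroup M] [Module S M] (N : Submodule S M)
    (W : Submodule S N) (hW : W ≠ ⊥) : W.map N.subtype ≠ ⊥ := by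
  obtain ⟨x, hx, hx0⟩ := (Submodule.ne_bot_iff _).mp hW
  exact (Submodule.ne_bot_iff _).mpr ⟨x, ⟨x, hx, rfl⟩, fun h => hx0 (Subtype.ext h)⟩

theorem submod_div [IsNoetherian S M] (H : SkewD α φ θ)
    (u : (PowerSeries k)ˣ) (hu : α X = (u : PowerSeries k) * X)
    (U : Submodule S M) (hU : ∀ W : Submodule S M, W ≠ ⊥ → U ≤ W)
    (hxU : ∃ v ∈ U, φ X • v ≠ 0) (N : Submodule S M) (x : M) (hx : x ∈ N) :
    ∃ y ∈ N, x = φ X • y := by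
  by_cases hN : N = ⊥
  · subst hN
    exact ⟨0, Submodule.zero_mem _, by simpa using hx⟩
  have hUN := hU N hN
  let _ : Module (PowerSeries k) N := Module.compHom N φ
  obtain ⟨y, hy⟩ := core2_div (M := N) H (fun _ _ => rfl) u hu (U.comap N.subtype) (by
    intro W hW
    have h1 : W.map N.subtype ≠ ⊥ := map_sub_ne_bot N W hW
    intro w hw
    obtain ⟨w', hw', e⟩ := hU _ h1 hw
    have : w' = w := Subtype.ext e
    exact this ▸ hw') (by
    obtain ⟨v, hv, hv0⟩ := hxU
    exact ⟨⟨v, hUN hv⟩, hv, fun h => hv0 (congrArg Subtype.val h)⟩) ⟨x, hx⟩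
  exact ⟨y, y.2, congrArg Subtype.val hy⟩

theorem core2 [IsNoetherian S M] (H : SkewD α φ θ)
    (u : (PowerSeries k)ˣ) (hu : α X = (u : PowerSeries k) * X)
    (U : Submodule S M) (hU : ∀ W : Submodule S M, W ≠ ⊥ → U ≤ W)
    (hxU : ∃ v ∈ U, φ X • v ≠ 0) : IsArtinian S M := by
  let _ : Module (PowerSeries k) M := Module.compHom M φ
  have hc : ∀ (r : PowerSeries k) (m : M), r • m = φ r • m := fun _ _ => rfl
  have hinj := X_inj H u hu U hU hxU
  have hrank := core2_rank H hc u hu inferInstance U hU hxU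
  have hdiv := submod_div H u hu U hU hxU
  have hinjn : ∀ (n : ℕ) (m : M), φ X ^ n • m = 0 → m = 0 := by
    intro n
    induction n with
    | zero => intro m h; simpa using h
    | succ n ih => intro m h; rw [pow_succ', mul_smul] at h; exact ih m (hinj _ h)
  have hdivn : ∀ (N : Submodule S M) (n : ℕ) (x : M), x ∈ N → ∃ y ∈ N, x = φ X ^ n • y := by
    intro N n
    induction n with
    | zero => intro x hx; exact ⟨x, hx, by simp⟩
    | succ n ih =>
      intro x hx
      obtain ⟨y, hy, rfl⟩ := ih x hx
      obtain ⟨z, hz, rfl⟩ := hdiv N y hy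
      exact ⟨z, hz, by rw [pow_succ, mul_smul]⟩
  have hpure : ∀ (N : Submodule S M) (r : PowerSeries k) (x : M), r ≠ 0 → r • x ∈ N → x ∈ N := by
    intro N r x hr hrx
    obtain ⟨n, w, rfl⟩ := IsDiscreteValuationRing.eq_unit_mul_pow_irreducible hr
      (PowerSeries.X_prime (R := k)).irreducible
    have h1 : φ X ^ n • x ∈ N := by
      have := N.smul_mem (φ (↑w⁻¹ : PowerSeries k)) hrx
      rw [hc, smul_smul, ← map_mul, ← mul_assoc, Units.inv_mul, one_mul, map_pow] at this
      exact this
    obtain ⟨y, hy, e⟩ := hdivn N n _ h1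
    have h2 := hinjn n (x - y) (by rw [smul_sub, e, sub_self])
    rw [sub_eq_zero] at h2
    exact h2 ▸ hy
  refine artin_of_strict (fun N => Cardinal.toNat (Module.rank (PowerSeries k) (resS φ hc N))) ?_
  intro N N' hlt
  have hle : resS φ hc N ≤ resS φ hc N' := fun x hx => hlt.le hx
  let L := (resS φ hc N).comap (resS φ hc N').subtype
  have h1 := rank_quotient_add_rank_of_isDomain L
  have h2 : Module.rank (PowerSeries k) L = Module.rank (PowerSeries k) (resS φ hc N) :=
    (Submodule.comapSubtypeEquivOfLe hle).rank_eq
  have h3 : Module.rank (PowerSeries k) (↥(resS φ hc N') ⧸ L) ≠ 0 := by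
    intro h
    rw [rank_eq_zero_iff] at h
    obtain ⟨x, hx', hx⟩ := SetLike.exists_of_lt hlt
    obtain ⟨r, hr, e⟩ := h (Submodule.Quotient.mk ⟨x, hx'⟩)
    rw [← Submodule.Quotient.mk_smul, Submodule.Quotient.mk_eq_zero] at e
    exact hx (hpure N r x hr e)
  have h4 : Module.rank (PowerSeries k) (resS φ hc N') < Cardinal.aleph0 :=
    (Submodule.rank_le _).trans_lt hrank
  rw [h2] at h1
  have h5 := h4
  rw [← h1, Cardinal.add_lt_aleph0_iff] at h5
  show Cardinal.toNat _ < Cardinal.toNat _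
  rw [← h1, Cardinal.toNat_add h5.1 h5.2]
  have : Cardinal.toNat (Module.rank (PowerSeries k) (↥(resS φ hc N') ⧸ L)) ≠ 0 := by
    rw [Ne, Cardinal.toNat_eq_zero]
    push Not
    exact ⟨h3, h5.1⟩
  omega

theorem core1 [IsNoetherian S M] (H : SkewD α φ θ) (hC : ∀ a : k, α (C a) = C a)
    (u : (PowerSeries k)ˣ) (hu : α X = (u : PowerSeries k) * X)
    (U : Submodule S M) (hU0 : U ≠ ⊥) (hU : ∀ W : Submodule S M, W ≠ ⊥ → U ≤ W)
    (hxU : ∀ v ∈ U, φ X • v = 0) : IsArtinian S M := by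
  have hmono : Monotone (fun n => (kerX H u hu n : Submodule S M)) := by
    refine monotone_nat_of_le_succ fun n => ?_
    intro m (hm : _ = _)
    show _ = _
    rw [pow_succ', mul_smul, hm, smul_zero]
  obtain ⟨n0, hn0⟩ := monotone_stabilizes_iff_noetherian.mpr (inferInstance : IsNoetherian S M) ⟨_, hmono⟩
  have hn0 : ∀ m, n0 ≤ m → (kerX H u hu n0 : Submodule S M) = kerX H u hu m := hn0
  obtain ⟨v, hv, hv0⟩ := U.ne_bot_iff.mp hU0
  -- X nilpotent
  have hnil : ∀ m : M, φ X ^ (n0 + 1) • m = 0 := by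
    have hr : (rangeX H u hu (n0 + 1) : Submodule S M) = ⊥ := by
      by_contra hne
      obtain ⟨y, hy⟩ : ∃ y, v = φ X ^ (n0 + 1) • y := hU _ hne hv
      have h1 : y ∈ (kerX H u hu (n0 + 2) : Submodule S M) := by
        show φ X ^ (n0 + 2) • y = 0
        rw [show n0 + 2 = (n0 + 1) + 1 by omega, pow_succ', mul_smul, ← hy]
        exact hxU v hv
      rw [← hn0 _ (by omega), hn0 (n0 + 1) (by omega)] at h1
      exact hv0 (hy.trans h1)
    intro m
    have : φ X ^ (n0 + 1) • m ∈ (rangeX H u hu (n0 + 1) : Submodule S M) := ⟨m, rfl⟩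
    rwa [hr, Submodule.mem_bot] at this
  let _ : Module k M := Module.compHom M (φ.comp C)
  have hck : ∀ (r : k) (m : M), r • m = (φ.comp C) r • m := fun _ _ => rfl
  let K : Submodule S M := kerX H u hu 1
  have hK : ∀ x : K, φ X • x = 0 := by
    intro x
    have : φ X ^ 1 • (x : M) = 0 := x.2
    rw [pow_one] at this
    exact Subtype.ext this
  let _ : Module k K := Module.compHom K (φ.comp C)
  have hcK : ∀ (r : k) (m : K), r • m = φ (C r) • m := fun _ _ => rfl
  have hcc : ∀ (r : PowerSeries k) (m : K), φ r • m = (constantCoeff r) • m := by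
    intro r m
    obtain ⟨s, hs⟩ : (X : PowerSeries k) ∣ r - C (constantCoeff r) :=
      X_dvd_iff.mpr (by simp)
    have : r = s * X + C (constantCoeff r) := by rw [mul_comm, ← hs]; ring
    conv_lhs => rw [this]
    rw [map_add, map_mul, add_smul, mul_smul, hK, smul_zero, zero_add, hcK]
  have hΘ : ∀ (r : k) (m : K), Th K θ (r • m) = (RingEquiv.refl k) r • Th K θ m := by
    intro r m
    rw [Th_apply, Th_apply, RingEquiv.refl_apply, hcK, hcK, smul_smul, H.comm, mul_smul, hC]
  have hact : ∀ (s : S) (m : K), ∃ (N : ℕ) (c : ℕ → k),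
      s • m = ∑ i ∈ Finset.range N, c i • (Th K θ)^[i] m := by
    intro s m
    obtain ⟨N, c, rfl⟩ := H.surj s
    refine ⟨N, fun i => constantCoeff (c i), ?_⟩
    rw [Finset.sum_smul]
    exact Finset.sum_congr rfl fun i _ => by rw [Th_iter, mul_smul, hcc]
  have hUK : U ≤ K := fun v hv => by
    show φ X ^ 1 • v = 0
    rw [pow_one]; exact hxU v hv
  have hU' : ∀ W : Submodule S K, W ≠ ⊥ → U.comap K.subtype ≤ W := by
    intro W hW
    have h1 : W.map K.subtype ≠ ⊥ := map_sub_ne_bot K W hW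
    intro w hw
    obtain ⟨w', hw', e⟩ := hU _ h1 hw
    have : w' = w := Subtype.ext e
    exact this ▸ hw'
  let v' : K := ⟨v, hUK hv⟩
  have hv' : v' ∈ U.comap K.subtype := hv
  have hv0' : v' ≠ 0 := fun h => hv0 (congrArg Subtype.val h)
  have hva : Algc k (Th K θ) v' := by
    by_cases hθ : θ • v' = 0
    · refine algc_step (RingEquiv.refl k) (Th K θ) hΘ v' (fun i => if i = 1 then 1 else 0) 2
        ⟨1, by omega, by simp⟩ ?_
      have : ∑ i ∈ Finset.range 2, (if i = 1 then (1 : k) else 0) • (Th K θ)^[i] v' = 0 := by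
        simp [Th_apply, hθ]
      rw [this]; exact algc_zero _
    · have h1 : v' ∈ Submodule.span S {θ • v'} := hU' _ (by simpa using hθ) hv'
      obtain ⟨s, hs⟩ := Submodule.mem_span_singleton.mp h1
      obtain ⟨N, c, hcs⟩ := hact s (θ • v')
      rw [hs] at hcs
      let c' : ℕ → k := fun i => Nat.casesOn i (-1) c
      refine algc_step (RingEquiv.refl k) (Th K θ) hΘ v' c' (N + 1) ⟨0, by omega, by simp [c']⟩ ?_
      have : ∑ i ∈ Finset.range (N + 1), c' i • (Th K θ)^[i] v' = 0 := by
        rw [Finset.sum_range_succ']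
        have e : ∑ i ∈ Finset.range N, c' (i + 1) • (Th K θ)^[i + 1] v' = v' := by
          conv_rhs => rw [hcs]
          exact Finset.sum_congr rfl fun i _ => by rw [Function.iterate_succ_apply, Th_apply]
        rw [e]
        simp [c']
      rw [this]; exact algc_zero _
  obtain ⟨B, hB, hBs⟩ := algc_sat θ hact inferInstance
    (mono_algc θ (RingEquiv.refl k) hΘ hact _ hU' v' hv' hv0' hva)
  have hBtop : B = ⊤ := by
    refine top_unique fun x _ => ?_
    obtain ⟨r, hr, h⟩ := hBs x
    have := B.smul_mem r⁻¹ h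
    rwa [smul_smul, inv_mul_cancel₀ hr, one_smul] at this
  rw [hBtop] at hB
  -- multiplication by X
  let ξ : M →ₗ[k] M :=
    { toFun := fun m => φ X • m
      map_add' := smul_add _
      map_smul' := by
        intro r m
        show φ X • (φ (C r) • m) = φ (C r) • (φ X • m)
        rw [smul_smul, smul_smul, ← map_mul, ← map_mul, mul_comm] }
  let ι : K →ₗ[k] M :=
    { toFun := fun m => m
      map_add' := fun _ _ => rfl
      map_smul' := fun _ _ => rfl }
  have hkfg : (LinearMap.ker ξ).FG := by
    have : LinearMap.ker ξ = (⊤ : Submodule k K).map ι := by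
      ext x
      constructor
      · intro (hx : φ X • x = 0)
        exact ⟨⟨x, by show φ X ^ 1 • x = 0; rwa [pow_one]⟩, trivial, rfl⟩
      · rintro ⟨y, _, rfl⟩
        exact congrArg Subtype.val (hK y)
    rw [this]; exact hB.map _
  have hkn : ∀ n, (resS (φ.comp C) hck (kerX H u hu n : Submodule S M)).FG := by
    intro n
    induction n with
    | zero =>
      have : resS (φ.comp C) hck (kerX H u hu 0 : Submodule S M) = ⊥ := by
        rw [eq_bot_iff]
        intro x (hx : φ X ^ 0 • x = 0)
        simpa using hx
      rw [this]; exact Submodule.fg_bot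
    | succ n ih =>
      have : Module.Finite k (resS (φ.comp C) hck (kerX H u hu n : Submodule S M)) :=
        Module.Finite.iff_fg.mpr ih
      have : Module.Finite k (LinearMap.ker ξ) := Module.Finite.iff_fg.mpr hkfg
      refine Submodule.fg_of_fg_map_of_fg_inf_ker ξ ?_ ?_
      · refine (isNoetherian_submodule (N := resS (φ.comp C) hck (kerX H u hu n : Submodule S M))).mp inferInstance _ ?_
        rintro _ ⟨y, hy, rfl⟩
        have hy : φ X ^ (n + 1) • y = 0 := hy
        show φ X ^ n • (φ X • y) = 0
        rwa [smul_smul, ← pow_succ]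
      · exact (isNoetherian_submodule (N := LinearMap.ker ξ)).mp inferInstance _ inf_le_right
  have htop : resS (φ.comp C) hck (kerX H u hu (n0 + 1) : Submodule S M) = ⊤ :=
    top_unique fun x _ => hnil x
  have hfink : Module.Finite k M := ⟨htop ▸ hkn (n0 + 1)⟩
  refine artin_of_strict (fun N => Module.finrank k (resS (φ.comp C) hck N)) ?_
  intro N N' hlt
  exact Submodule.finrank_lt_finrank_of_lt (s := resS (φ.comp C) hck N)
    (t := resS (φ.comp C) hck N') hlt

theorem core (H : SkewD α φ θ) (hC : ∀ a : k, α (C a) = C a)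
    (u : (PowerSeries k)ˣ) (hu : α X = (u : PowerSeries k) * X) (hfin : Module.Finite S M)
    (U : Submodule S M) (hU0 : U ≠ ⊥) (hU : ∀ W : Submodule S M, W ≠ ⊥ → U ≤ W) :
    IsArtinian S M := by
  have := H.noeth
  by_cases hxU : ∃ v ∈ U, φ X • v ≠ 0
  · exact core2 H u hu U hU hxU
  · push Not at hxU
    exact core1 H hC u hu U hU0 hU hxU

theorem exists_unit_X (α : PowerSeries k ≃+* PowerSeries k) :
    ∃ u : (PowerSeries k)ˣ, α X = (u : PowerSeries k) * X := by
  have h1 : Irreducible (X : PowerSeries k) := X_prime.irreducible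
  have h2 : Irreducible (α X) := (MulEquiv.irreducible_iff α).mpr h1
  obtain ⟨w, hw⟩ := IsDiscreteValuationRing.associated_of_irreducible _ h1 h2
  exact ⟨w, by rw [mul_comm, hw]⟩

theorem SkewD.opp {R S : Type*} [CommRing R] [Ring S] {α : R ≃+* R} {φ : R →+* S} {θ : S}
    (H : SkewD α φ θ) :
    SkewD α.symm (φ.toOpposite fun x y => by
      show _ = _
      rw [← map_mul, mul_comm, map_mul]) (MulOpposite.op θ) := by
  constructor
  · intro r
    show MulOpposite.op (φ r * θ) = MulOpposite.op (θ * φ (α.symm r))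
    rw [H.comm, α.apply_symm_apply]
  · intro s
    obtain ⟨N, c, h⟩ := H.surj s.unop
    refine ⟨N, fun i => α.symm^[i] (c i), ?_⟩
    apply MulOpposite.unop_injective
    rw [h, Finset.unop_sum]
    refine Finset.sum_congr rfl fun i _ => ?_
    show _ = θ ^ i * φ (α.symm^[i] (c i))
    have e2 : α^[i] (α.symm^[i] (c i)) = c i := Function.LeftInverse.iterate α.right_inv i _
    rw [H.comm_pow, e2]

end Art

theorem main_left {k S : Type u} [Field k] [Ring S]
    {α : PowerSeries k ≃+* PowerSeries k} {φ : PowerSeries k →+* S} {θ : S}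
    (H : SkewD α φ θ) (hC : ∀ a : k, α (PowerSeries.C a) = PowerSeries.C a) : HasDiamond S := by
  intro V E _ _ _ _ f hV hf N hN
  obtain ⟨-, hinj, hess⟩ := hf
  obtain ⟨u, hu⟩ := exists_unit_X α
  have hfin : Module.Finite S N := Module.Finite.iff_fg.mpr hN
  by_cases hN0 : N = ⊥
  · subst hN0
    infer_instance
  have hmin : ∀ W : Submodule S E, W ≠ ⊥ → LinearMap.range f ≤ W := by
    intro W hW
    have h1 := hess W hW
    have h2 : W.comap f ≠ ⊥ := by
      obtain ⟨x, ⟨hxW, ⟨y, rfl⟩⟩, hx0⟩ := (Submodule.ne_bot_iff _).mp h1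
      exact (Submodule.ne_bot_iff _).mpr ⟨y, hxW, fun h => hx0 (by rw [h, map_zero])⟩
    rcases eq_bot_or_eq_top (W.comap f) with h | h
    · exact absurd h h2
    · rintro _ ⟨y, rfl⟩
      have : y ∈ W.comap f := by rw [h]; trivial
      exact this
  have hUN := hmin N hN0
  refine core H hC u hu hfin ((LinearMap.range f).comap N.subtype) ?_ ?_
  · obtain ⟨x, ⟨hxW, hx⟩, hx0⟩ := (Submodule.ne_bot_iff _).mp (hess N hN0)
    exact (Submodule.ne_bot_iff _).mpr ⟨⟨x, hxW⟩, hx, fun h => hx0 (congrArg Subtype.val h)⟩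
  · intro W hW
    have h1 : W.map N.subtype ≠ ⊥ := map_sub_ne_bot N W hW
    intro w hw
    obtain ⟨w', hw', e⟩ := hmin _ h1 hw
    have : w' = w := Subtype.ext e
    exact this ▸ hw'

/-- Let `k` be a field and `α` any `k`-algebra automorphism of `k[[X]]`.
Then `Ŝ = k[[X]][θ; α]` satisfies `(◊)`: the injective hull of every simple right
`Ŝ`-module and of every simple left `Ŝ`-module is locally Artinian. -/
theorem diamond_for_skew_power_series
    {k : Type u} [Field k] (α : PowerSeries k ≃ₐ[k] PowerSeries k)
    {S : Type u} [Ring S] (φ : PowerSeries k →+* S) (θ : S)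
    (hS : IsSkewPolynomialRing α.toRingEquiv φ θ) :
    HasDiamond Sᵐᵒᵖ ∧ HasDiamond S := by
  have H : SkewD α.toRingEquiv φ θ := by
    refine ⟨hS.commutes, fun s => ?_⟩
    obtain ⟨p, rfl⟩ := hS.bijective.2 s
    refine ⟨p.support.sup id + 1, p, ?_⟩
    refine Finset.sum_subset ?_ ?_
    · intro i hi
      exact Finset.mem_range.mpr (Nat.lt_succ_of_le (Finset.le_sup (f := id) hi))
    · intro i _ hi
      show φ (p i) * θ ^ i = 0
      rw [Finsupp.notMem_support_iff.mp hi, map_zero, zero_mul]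
  have hC : ∀ a : k, α.toRingEquiv (PowerSeries.C a) = PowerSeries.C a := fun a => α.commutes a
  refine ⟨main_left H.opp fun a => ?_, main_left H hC⟩
  rw [RingEquiv.symm_apply_eq, hC]
end

section
/- Let b and c be irreducible elements of Ŝ, respectively of type (B) and of type (C). Then there exist irreducible elements b' and c' of Ŝ, respectively similar to b and to c, such that cb = b'c'. -/
open MulOpposite

universe u

namespace SkewAux

open PowerSeries in
/-- constant coefficients are fixed by algebra automorphisms -/
lemma cc_alg {k : Type u} [Field k] (α : PowerSeries k ≃ₐ[k] PowerSeries k) (r : PowerSeries k) :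
    constantCoeff (α r) = constantCoeff r := by
  set a := constantCoeff r
  have h1 : ¬ IsUnit (r - C a) := by
    rw [isUnit_iff_constantCoeff]; simp [a]
  have h2 : ¬ IsUnit (α (r - C a)) := by
    intro h; apply h1
    have := h.map α.symm
    simpa using this
  rw [isUnit_iff_constantCoeff] at h2
  have h3 : α (C a) = C a := by
    have := α.commutes a
    simpa [PowerSeries.algebraMap_apply] using this
  rw [map_sub, h3, map_sub, constantCoeff_C, isUnit_iff_ne_zero, not_not, sub_eq_zero] at h2
  exact h2

section
variable {k : Type u} [Field k] {α : PowerSeries k ≃ₐ[k] PowerSeries k}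
  {S : Type u} [Ring S] {φ : PowerSeries k →+* S} {θ : S}

noncomputable def ev (φ : PowerSeries k →+* S) (θ : S) : (ℕ →₀ PowerSeries k) →+ S :=
  Finsupp.liftAddHom (fun n => (AddMonoidHom.mulRight (θ ^ n)).comp φ.toAddMonoidHom)

lemma ev_single (n : ℕ) (r : PowerSeries k) : ev φ θ (Finsupp.single n r) = φ r * θ ^ n := by
  simp [ev]

variable (hS : IsSkewPolynomialRing α.toRingEquiv φ θ)
include hS

lemma ev_bij : Function.Bijective (ev φ θ) := by
  have := hS.bijective
  have h : (ev φ θ : (ℕ →₀ PowerSeries k) → S) = fun p => p.sum fun n r => φ r * θ ^ n := by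
    ext p
    rfl
  rw [h]; exact this

noncomputable def co : S →+ (ℕ →₀ PowerSeries k) :=
  ((AddEquiv.ofBijective (ev φ θ) (ev_bij hS)).symm : S ≃+ (ℕ →₀ PowerSeries k)).toAddMonoidHom

lemma ev_co (s : S) : ev φ θ (co hS s) = s :=
  (AddEquiv.ofBijective (ev φ θ) (ev_bij hS)).apply_symm_apply s

lemma co_ev (p : ℕ →₀ PowerSeries k) : co hS (ev φ θ p) = p :=
  (AddEquiv.ofBijective (ev φ θ) (ev_bij hS)).symm_apply_apply p

lemma co_mono (r : PowerSeries k) (n : ℕ) : co hS (φ r * θ ^ n) = Finsupp.single n r := by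
  rw [← ev_single, co_ev]

lemma co_ext {s t : S} (h : ∀ n, co hS s n = co hS t n) : s = t := by
  rw [← ev_co hS s, ← ev_co hS t]; congr 1; ext1 n; exact h n

lemma ind {P : S → Prop} (h0 : P 0) (ha : ∀ s t, P s → P t → P (s + t))
    (hm : ∀ r n, P (φ r * θ ^ n)) (s : S) : P s := by
  rw [← ev_co hS s]
  induction co hS s using Finsupp.induction_linear with
  | zero => simpa using h0
  | add f g hf hg => rw [map_add]; exact ha _ _ hf hg
  | single n r => rw [ev_single]; exact hm r n

lemma comm_pow (n : ℕ) (r : PowerSeries k) : θ ^ n * φ r = φ ((α ^ n) r) * θ ^ n := by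
  induction n generalizing r with
  | zero => simp
  | succ n ih =>
    have := hS.commutes r
    calc θ ^ (n+1) * φ r = θ ^ n * (θ * φ r) := by rw [pow_succ, mul_assoc]
      _ = θ ^ n * φ (α r) * θ := by rw [this, mul_assoc]; rfl
      _ = φ ((α ^ (n+1)) r) * θ ^ (n+1) := by
        rw [ih, mul_assoc, ← pow_succ]; congr 2

lemma co_mul (s t : S) (n : ℕ) : co hS (s * t) n =
    ∑ p ∈ Finset.HasAntidiagonal.antidiagonal n, co hS s p.1 * (α ^ p.1) (co hS t p.2) := by
  induction s using ind hS with
  | h0 => simp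
  | ha s s' h h' => simp [add_mul, h, h', Finset.sum_add_distrib]
  | hm r m =>
    induction t using ind hS with
    | h0 => simp
    | ha s s' h h' => simp only [mul_add, map_add, h, h', Finset.sum_add_distrib, Finsupp.add_apply]
    | hm r' m' =>
      have : φ r * θ ^ m * (φ r' * θ ^ m') = φ (r * (α ^ m) r') * θ ^ (m + m') := by
        rw [mul_assoc, ← mul_assoc (θ ^ m), comm_pow hS, map_mul, pow_add]; simp only [mul_assoc]
      rw [this, co_mono, co_mono, co_mono]
      by_cases hn : n = m + m'
      · subst hn
        rw [Finset.sum_eq_single (m, m')]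
        · simp
        · rintro ⟨a, b⟩ hab hne
          by_cases ha : a = m
          · subst ha
            have : b ≠ m' := by rintro rfl; exact hne rfl
            simp [Finsupp.single_apply, this.symm]
          · simp [Finsupp.single_apply, Ne.symm ha]
        · simp
      · rw [Finsupp.single_apply, if_neg (Ne.symm hn), eq_comm]
        apply Finset.sum_eq_zero
        rintro ⟨a, b⟩ hab
        rw [Finset.HasAntidiagonal.mem_antidiagonal] at hab
        by_cases ha : a = m
        · subst ha
          have : b ≠ m' := by rintro rfl; exact hn hab.symm
          simp [Finsupp.single_apply, this.symm]
        · simp [Finsupp.single_apply, Ne.symm ha]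

lemma co_phi (r : PowerSeries k) : co hS (φ r) = Finsupp.single 0 r := by
  have := co_mono hS r 0; simpa using this

lemma co_theta (n : ℕ) : co hS (θ ^ n) = Finsupp.single n 1 := by
  have := co_mono hS 1 n; simpa using this

lemma co_one : co hS 1 = Finsupp.single 0 1 := by
  have := co_mono hS 1 0; simpa using this

lemma co_phi_mul (r : PowerSeries k) (s : S) (n : ℕ) : co hS (φ r * s) n = r * co hS s n := by
  rw [co_mul, Finset.sum_eq_single (0, n)]
  · simp [co_phi]
  · rintro ⟨a, b⟩ hab hne
    rw [Finset.HasAntidiagonal.mem_antidiagonal] at hab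
    have : a ≠ 0 := by rintro rfl; apply hne; simp at hab; simp [hab]
    simp [co_phi, Finsupp.single_apply, this.symm]
  · simp

lemma co_mul_phi (r : PowerSeries k) (s : S) (n : ℕ) :
    co hS (s * φ r) n = co hS s n * (α ^ n) r := by
  rw [co_mul, Finset.sum_eq_single (n, 0)]
  · simp [co_phi]
  · rintro ⟨a, b⟩ hab hne
    rw [Finset.HasAntidiagonal.mem_antidiagonal] at hab
    have : b ≠ 0 := by rintro rfl; apply hne; simp at hab; simp [hab]
    simp [co_phi, Finsupp.single_apply, this.symm]
  · simp

/-- degree less than `n` -/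
def Bd (s : S) (n : ℕ) : Prop := ∀ i, n ≤ i → co hS s i = 0

lemma Bd.add {s t : S} {n : ℕ} (h : Bd hS s n) (h' : Bd hS t n) : Bd hS (s + t) n := by
  intro i hi; simp [h i hi, h' i hi]
lemma Bd.sub {s t : S} {n : ℕ} (h : Bd hS s n) (h' : Bd hS t n) : Bd hS (s - t) n := by
  intro i hi; simp [h i hi, h' i hi]
lemma Bd.zero (n : ℕ) : Bd hS 0 n := by intro i hi; simp
lemma Bd.mono {s : S} {n m : ℕ} (h : Bd hS s n) (hm : n ≤ m) : Bd hS s m :=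
  fun i hi => h i (hm.trans hi)
lemma Bd.phi_mul {s : S} {n : ℕ} (r : PowerSeries k) (h : Bd hS s n) : Bd hS (φ r * s) n := by
  intro i hi; simp [co_phi_mul, h i hi]
lemma Bd.mul_phi {s : S} {n : ℕ} (r : PowerSeries k) (h : Bd hS s n) : Bd hS (s * φ r) n := by
  intro i hi; simp [co_mul_phi, h i hi]
lemma Bd.mono' (r : PowerSeries k) (n : ℕ) : Bd hS (φ r * θ ^ n) (n + 1) := by
  intro i hi; rw [co_mono, Finsupp.single_apply, if_neg (by omega)]
lemma Bd.theta (n m : ℕ) (h : n < m) : Bd hS (θ ^ n) m := by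
  intro i hi; rw [co_theta, Finsupp.single_apply, if_neg (by omega)]
lemma exists_bd (s : S) : ∃ n, Bd hS s n := by
  refine ⟨(co hS s).support.sup id + 1, fun i hi => ?_⟩
  by_contra h
  have : i ≤ (co hS s).support.sup id := Finset.le_sup (f := id) (Finsupp.mem_support_iff.2 h)
  omega
lemma Bd.eq_zero {s : S} (h : Bd hS s 0) : s = 0 :=
  co_ext hS (fun n => by simp [h n (Nat.zero_le _)])
lemma Bd.pred {s : S} {n : ℕ} (h : Bd hS s (n+1)) (h' : co hS s n = 0) : Bd hS s n := by
  intro i hi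
  rcases hi.eq_or_lt with rfl | hi
  · exact h'
  · exact h i hi

lemma Bd.mul {s t : S} {m n : ℕ} (h : Bd hS s (m+1)) (h' : Bd hS t (n+1)) :
    Bd hS (s * t) (m + n + 1) := by
  intro i hi
  rw [co_mul]
  apply Finset.sum_eq_zero
  rintro ⟨a, b⟩ hab
  rw [Finset.HasAntidiagonal.mem_antidiagonal] at hab
  by_cases ha : m + 1 ≤ a
  · simp [h a ha]
  · simp [h' b (by simp at hab; omega)]

lemma co_mul_top {s t : S} {m n : ℕ} (h : Bd hS s (m+1)) (h' : Bd hS t (n+1)) :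
    co hS (s * t) (m + n) = co hS s m * (α ^ m) (co hS t n) := by
  rw [co_mul, Finset.sum_eq_single (m, n)]
  · rintro ⟨a, b⟩ hab hne
    rw [Finset.HasAntidiagonal.mem_antidiagonal] at hab
    by_cases ha : m + 1 ≤ a
    · simp [h a ha]
    · have : b ≠ n := by
        rintro rfl; apply hne; simp at hab; simp [hab]
      simp [h' b (by simp at hab; omega)]
  · simp

lemma exists_deg {s : S} (hs : s ≠ 0) : ∃ n, Bd hS s (n+1) ∧ co hS s n ≠ 0 := by
  obtain ⟨n, hn⟩ := exists_bd hS s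
  induction n with
  | zero => exact absurd (hn.eq_zero hS) hs
  | succ n ih =>
    by_cases h : co hS s n = 0
    · exact ih (hn.pred hS h)
    · exact ⟨n, hn, h⟩

lemma mul_ne {s t : S} (hs : s ≠ 0) (ht : t ≠ 0) : s * t ≠ 0 := by
  obtain ⟨m, hm, hm'⟩ := exists_deg hS hs
  obtain ⟨n, hn, hn'⟩ := exists_deg hS ht
  intro h
  have := co_mul_top hS hm hn
  rw [h, map_zero] at this
  rcases mul_eq_zero.1 this.symm with h | h
  · exact hm' h
  · exact hn' ((map_eq_zero_iff _ (α ^ m).injective).1 h)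

lemma lcancel {a s t : S} (ha : a ≠ 0) (h : a * s = a * t) : s = t := by
  by_contra hne
  exact mul_ne hS ha (sub_ne_zero.2 hne) (by rw [mul_sub, h, sub_self])
lemma rcancel {a s t : S} (ha : a ≠ 0) (h : s * a = t * a) : s = t := by
  by_contra hne
  exact mul_ne hS (sub_ne_zero.2 hne) ha (by rw [sub_mul, h, sub_self])

lemma one_ne : (1 : S) ≠ 0 := by
  intro h
  have := co_one hS
  rw [h, map_zero] at this
  have h2 := DFunLike.congr_fun this 0
  simp at h2

lemma isUnit_of_mul {a s : S} (h : a * s = 1) : IsUnit a := by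
  have ha : a ≠ 0 := by rintro rfl; rw [zero_mul] at h; exact one_ne hS h.symm
  refine ⟨⟨a, s, h, lcancel hS ha ?_⟩, rfl⟩
  rw [← mul_assoc, h, one_mul, mul_one]
lemma isUnit_of_mul' {a s : S} (h : s * a = 1) : IsUnit a := by
  have ha : a ≠ 0 := by rintro rfl; rw [mul_zero] at h; exact one_ne hS h.symm
  refine ⟨⟨a, s, rcancel hS ha ?_, h⟩, rfl⟩
  rw [mul_assoc, h, one_mul, mul_one]

lemma phiX_ne : φ PowerSeries.X ≠ 0 := by
  intro h
  have := co_phi hS PowerSeries.X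
  rw [h, map_zero] at this
  have h2 := DFunLike.congr_fun this 0
  simp at h2
  exact PowerSeries.X_ne_zero h2.symm

/-- degree exactly `n` with unit leading coefficient -/
def Reg (s : S) (n : ℕ) : Prop := Bd hS s (n+1) ∧ IsUnit (co hS s n)

lemma Reg.ne {s : S} {n : ℕ} (h : Reg hS s n) : s ≠ 0 := by
  rintro rfl
  have := h.2
  simp at this

lemma rdiv {c : S} {n : ℕ} (hc : Reg hS c n) (s : S) : ∃ q r, s = c * q + r ∧ Bd hS r n := by
  obtain ⟨m, hm⟩ := exists_bd hS s
  induction m generalizing s with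
  | zero => exact ⟨0, s, by simp, hm.mono hS (Nat.zero_le _)⟩
  | succ m ih =>
    by_cases hmn : m < n
    · exact ⟨0, s, by simp, hm.mono hS hmn⟩
    obtain ⟨j, rfl⟩ := Nat.exists_eq_add_of_le (not_lt.1 hmn)
    obtain ⟨u, hu⟩ := hc.2
    set t := (α ^ n).symm (↑u⁻¹ * co hS s (n + j))
    have h1 := co_mul_top hS hc.1 (Bd.mono' hS t j)
    have h2 := Bd.mul hS hc.1 (Bd.mono' hS t j)
    rw [co_mono, Finsupp.single_eq_same] at h1
    have ht : (α ^ n) t = ↑u⁻¹ * co hS s (n + j) := AlgEquiv.apply_symm_apply _ _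
    rw [ht, ← hu, Units.mul_inv_cancel_left] at h1
    obtain ⟨q, r, h, hr⟩ := ih (s - c * (φ t * θ ^ j))
      ((hm.sub hS h2).pred hS (by simp only [map_sub, Finsupp.sub_apply, h1, sub_self]))
    refine ⟨φ t * θ ^ j + q, r, ?_, hr⟩
    rw [mul_add, add_assoc, ← h]; abel

lemma ldiv {c : S} {n : ℕ} (hc : Reg hS c n) (s : S) : ∃ q r, s = q * c + r ∧ Bd hS r n := by
  obtain ⟨m, hm⟩ := exists_bd hS s
  induction m generalizing s with
  | zero => exact ⟨0, s, by simp, hm.mono hS (Nat.zero_le _)⟩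
  | succ m ih =>
    by_cases hmn : m < n
    · exact ⟨0, s, by simp, hm.mono hS hmn⟩
    obtain ⟨j, rfl⟩ := Nat.exists_eq_add_of_le' (not_lt.1 hmn)
    obtain ⟨u, hu⟩ := hc.2.map (α ^ j)
    set t := co hS s (j + n) * ↑u⁻¹
    have h1 := co_mul_top hS (Bd.mono' hS t j) hc.1
    have h2 := Bd.mul hS (Bd.mono' hS t j) hc.1
    rw [co_mono, Finsupp.single_eq_same, ← hu, Units.inv_mul_cancel_right] at h1
    obtain ⟨q, r, h, hr⟩ := ih (s - (φ t * θ ^ j) * c)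
      ((hm.sub hS h2).pred hS (by simp only [map_sub, Finsupp.sub_apply, h1, sub_self]))
    refine ⟨φ t * θ ^ j + q, r, ?_, hr⟩
    rw [add_mul, add_assoc, ← h]; abel

lemma cc_pow (n : ℕ) (r : PowerSeries k) :
    PowerSeries.constantCoeff ((α ^ n) r) = PowerSeries.constantCoeff r := cc_alg _ r

/-- reduction modulo `X` -/
noncomputable def prFun (s : S) : Polynomial k :=
  Polynomial.ofFinsupp
    (AddMonoidAlgebra.ofCoeff ((co hS s).mapRange PowerSeries.constantCoeff (map_zero _)))

lemma coeff_prFun (s : S) (n : ℕ) :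
    (prFun hS s).coeff n = PowerSeries.constantCoeff (co hS s n) := rfl

noncomputable def pr : S →+* Polynomial k where
  toFun s := prFun hS s
  map_one' := by
    ext n
    rw [coeff_prFun, co_one, Polynomial.coeff_one, Finsupp.single_apply]
    by_cases h : n = 0
    · simp [h]
    · simp [h, Ne.symm h]
  map_mul' s t := by
    ext n
    rw [coeff_prFun, co_mul, Polynomial.coeff_mul, map_sum]
    simp only [coeff_prFun, map_mul, cc_pow hS]
  map_zero' := by
    ext n
    simp [coeff_prFun]
  map_add' s t := by
    ext n
    simp [coeff_prFun]

lemma coeff_pr (s : S) (n : ℕ) :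
    (pr hS s).coeff n = PowerSeries.constantCoeff (co hS s n) := rfl

lemma pr_phi (r : PowerSeries k) : pr hS (φ r) = Polynomial.C (PowerSeries.constantCoeff r) := by
  ext n
  rw [coeff_pr, co_phi, Polynomial.coeff_C, Finsupp.single_apply]
  by_cases h : n = 0
  · simp [h]
  · simp [h, Ne.symm h]

lemma pr_X : pr hS (φ PowerSeries.X) = 0 := by simp [pr_phi]

lemma pr_theta : pr hS θ = Polynomial.X := by
  ext n
  have := co_theta hS 1
  rw [pow_one] at this
  rw [coeff_pr, this, Polynomial.coeff_X, Finsupp.single_apply]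
  split_ifs <;> simp

lemma pr_surj (p : Polynomial k) : ∃ s : S, pr hS s = p ∧
    ∀ n, co hS s n = PowerSeries.C (p.coeff n) := by
  refine ⟨ev φ θ (p.toFinsupp.coeff.mapRange PowerSeries.C (map_zero _)), ?_, ?_⟩
  · ext n
    rw [coeff_pr, co_ev]
    simp
    rfl
  · intro n
    rw [co_ev]
    simp
    rfl

lemma pr_thetaPoly (p : Polynomial k) : pr hS (thetaPoly φ θ p) = p := by
  conv_rhs => rw [← Polynomial.sum_C_mul_X_pow_eq p]
  simp only [thetaPoly, Polynomial.sum, map_sum, map_mul, map_pow, pr_theta, pr_phi]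
  simp [PowerSeries.algebraMap_apply]

/-- elements whose coefficients are divisible by `X^m` -/
lemma of_dvd {s : S} {m : ℕ} (h : ∀ i, PowerSeries.X ^ m ∣ co hS s i) :
    ∃ t, s = φ PowerSeries.X ^ m * t ∧ ∀ n, Bd hS s n → Bd hS t n := by
  classical
  choose f hf using h
  have hX : (PowerSeries.X : PowerSeries k) ^ m ≠ 0 := pow_ne_zero _ PowerSeries.X_ne_zero
  have hf0 : ∀ i, co hS s i = 0 → f i = 0 := by
    intro i hi
    have := hf i
    rw [hi] at this
    exact (mul_eq_zero.1 this.symm).resolve_left hX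
  refine ⟨ev φ θ (Finsupp.onFinset (co hS s).support f ?_), ?_, ?_⟩
  · intro i hi
    rw [Finsupp.mem_support_iff]
    exact fun h => hi (hf0 i h)
  · apply co_ext hS
    intro n
    rw [← map_pow, co_phi_mul, co_ev, hf n]; rfl
  · intro n hn i hi
    rw [co_ev]
    exact hf0 i (hn i hi)

lemma of_pr {s : S} (h : pr hS s = 0) :
    ∃ t, s = φ PowerSeries.X * t ∧ ∀ n, Bd hS s n → Bd hS t n := by
  have := of_dvd hS (s := s) (m := 1) ?_
  · simpa using this
  · intro i
    rw [pow_one, PowerSeries.X_dvd_iff, ← coeff_pr, h, Polynomial.coeff_zero]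

lemma X_dvd_pow_iff (n : ℕ) : ∃ v, PowerSeries.X = v * (α ^ n) PowerSeries.X := by
  have h : (PowerSeries.X : PowerSeries k) ∣ (α ^ n).symm PowerSeries.X := by
    rw [PowerSeries.X_dvd_iff, cc_alg]; simp
  obtain ⟨w, hw⟩ := h
  refine ⟨(α ^ n) w, ?_⟩
  have := congrArg (α ^ n) hw
  rwa [AlgEquiv.apply_symm_apply, map_mul, mul_comm] at this

lemma X_swap (s : S) : ∃ t, φ PowerSeries.X * s = t * φ PowerSeries.X := by
  induction s using ind hS with
  | h0 => exact ⟨0, by simp⟩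
  | ha s s' h h' =>
    obtain ⟨t, h⟩ := h
    obtain ⟨t', h'⟩ := h'
    exact ⟨t + t', by rw [mul_add, add_mul, h, h']⟩
  | hm r n =>
    obtain ⟨v, hv⟩ := X_dvd_pow_iff hS n
    refine ⟨φ (r * v) * θ ^ n, ?_⟩
    rw [mul_assoc, comm_pow hS, ← mul_assoc, ← mul_assoc, ← map_mul, ← map_mul, mul_assoc r v, ← hv,
      mul_comm r]

lemma X_swap' (s : S) : ∃ t, s * φ PowerSeries.X = φ PowerSeries.X * t := by
  obtain ⟨t, ht, -⟩ := of_pr hS (s := s * φ PowerSeries.X) (by rw [map_mul, pr_X, mul_zero])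
  exact ⟨t, ht⟩

lemma Xpow_swap' (m : ℕ) (s : S) : ∃ t, s * φ PowerSeries.X ^ m = φ PowerSeries.X ^ m * t := by
  induction m generalizing s with
  | zero => exact ⟨s, by simp⟩
  | succ m ih =>
    obtain ⟨t, ht⟩ := ih s
    obtain ⟨t', ht'⟩ := X_swap' hS t
    exact ⟨t', by rw [pow_succ, ← mul_assoc, ht, mul_assoc, ht', mul_assoc]⟩

lemma of_pr' {s : S} (h : pr hS s = 0) :
    ∃ t, s = t * φ PowerSeries.X ∧ ∀ n, Bd hS s n → Bd hS t n := by
  obtain ⟨t, ht, -⟩ := of_pr hS h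
  obtain ⟨t', ht'⟩ := X_swap hS t
  refine ⟨t', ht.trans ht', ?_⟩
  intro n hn i hi
  have := hn i hi
  rw [ht, ht', co_mul_phi] at this
  refine (mul_eq_zero.1 this).resolve_right ?_
  intro h
  exact PowerSeries.X_ne_zero ((map_eq_zero_iff _ (α ^ i).injective).1 h)

lemma eq_zero_of_dvd {s : S} (h : ∀ m i, PowerSeries.X ^ m ∣ co hS s i) : s = 0 := by
  apply co_ext hS
  intro i
  ext j
  have := PowerSeries.X_pow_dvd_iff.1 (h (j+1) i) j (Nat.lt_succ_self _)
  simpa using this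

lemma Reg.natDegree {s : S} {n : ℕ} (h : Reg hS s n) : (pr hS s).natDegree = n := by
  apply Polynomial.natDegree_eq_of_le_of_coeff_ne_zero
  · rw [Polynomial.natDegree_le_iff_coeff_eq_zero]
    intro i hi
    rw [coeff_pr, h.1 i hi, map_zero]
  · rw [coeff_pr]
    exact (PowerSeries.isUnit_iff_constantCoeff.1 h.2).ne_zero

lemma Reg.pr_ne {s : S} {n : ℕ} (h : Reg hS s n) : pr hS s ≠ 0 := by
  intro h0
  have := coeff_pr hS s n
  rw [h0, Polynomial.coeff_zero] at this
  exact (PowerSeries.isUnit_iff_constantCoeff.1 h.2).ne_zero this.symm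

lemma Bd.degree {s : S} {n : ℕ} (h : Bd hS s n) : (pr hS s).degree < n := by
  rw [Polynomial.degree_lt_iff_coeff_zero]
  intro i hi
  rw [coeff_pr, h i hi, map_zero]

lemma Bd.pr_zero {r : S} {n : ℕ} (h : Bd hS r n) {f : Polynomial k} (hf : f.natDegree = n)
    (hd : f ∣ pr hS r) : pr hS r = 0 := by
  by_contra hne
  have h1 := h.degree hS
  have h2 := Polynomial.natDegree_le_of_dvd hd hne
  rw [Polynomial.degree_eq_natDegree hne] at h1
  have : (pr hS r).natDegree < n := by exact_mod_cast h1
  omega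

end
end SkewAux

namespace SkewAux
section
variable {k : Type u} [Field k] {α : PowerSeries k ≃ₐ[k] PowerSeries k}
  {S : Type u} [Ring S] {φ : PowerSeries k →+* S} {θ : S}
  (hS : IsSkewPolynomialRing α.toRingEquiv φ θ)
include hS

lemma nak (P : AddSubgroup S) (hP : ∀ s ∈ P, ∀ r, s * φ r ∈ P) (n : ℕ)
    (h : ∀ s, Bd hS s n → ∃ p ∈ P, ∃ s', Bd hS s' n ∧ s = p + s' * φ PowerSeries.X)
    (s : S) (hs : Bd hS s n) : s ∈ P := by
  classical
  letI : Module (PowerSeries k) S :=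
    Module.compHom S (φ.toOpposite (fun x y => by
      show φ x * φ y = φ y * φ x
      rw [← map_mul, ← map_mul, mul_comm]))
  have smul_def : ∀ (r : PowerSeries k) (s : S), r • s = s * φ r := fun r s => rfl
  let P' : Submodule (PowerSeries k) S :=
    { P with smul_mem' := fun r s hs => hP s hs r }
  let N : Submodule (PowerSeries k) S :=
    Submodule.span (PowerSeries k) ((Finset.range n).image (fun i => θ ^ i) : Finset S)
  have hmem : ∀ m ≤ n, ∀ s, Bd hS s m → s ∈ N := by
    intro m
    induction m with
    | zero => intro _ s hs; rw [hs.eq_zero hS]; exact N.zero_mem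
    | succ m ih =>
      intro hm s hs
      set r := (α ^ m).symm (co hS s m)
      have hr : (α ^ m) r = co hS s m := AlgEquiv.apply_symm_apply _ _
      have h1 : Bd hS (s - θ ^ m * φ r) m := by
        apply Bd.pred
        · exact hs.sub hS ((Bd.theta hS m (m+1) (Nat.lt_succ_self _)).mul_phi hS r)
        · rw [map_sub, Finsupp.sub_apply, co_mul_phi, co_theta, Finsupp.single_eq_same, one_mul, hr,
            sub_self]
      have h2 : θ ^ m * φ r ∈ N := by
        rw [← smul_def]
        apply N.smul_mem
        apply Submodule.subset_span
        simp only [Finset.coe_image, Set.mem_image, Finset.coe_range, Set.mem_Iio]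
        exact ⟨m, hm, rfl⟩
      have := N.add_mem (ih (by omega) _ h1) h2
      rwa [sub_add_cancel] at this
  have key : N ≤ P' := by
    apply Submodule.le_of_le_smul_of_le_jacobson_bot (I := Ideal.span {PowerSeries.X})
    · exact Submodule.fg_span (Finset.finite_toSet _)
    · rw [IsLocalRing.jacobson_eq_maximalIdeal _ bot_ne_top, Ideal.span_singleton_le_iff_mem]
      rw [IsLocalRing.mem_maximalIdeal, mem_nonunits_iff, PowerSeries.isUnit_iff_constantCoeff]
      simp
    · apply Submodule.span_le.2
      intro s hs
      simp only [Finset.coe_image, Set.mem_image, Finset.coe_range, Set.mem_Iio] at hs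
      obtain ⟨i, hi, rfl⟩ := hs
      obtain ⟨p, hp, s', hs', h⟩ := h _ (Bd.theta hS i n hi)
      rw [SetLike.mem_coe, h]
      refine Submodule.add_mem_sup hp ?_
      rw [← smul_def]
      exact Submodule.smul_mem_smul (Ideal.mem_span_singleton_self _) (hmem n le_rfl _ hs')
  exact key (hmem n le_rfl s hs)

lemma span_all {c x : S} {n : ℕ} (hc : Reg hS c n) (hx : IsCoprime (pr hS x) (pr hS c)) (s : S) :
    ∃ q r, s = c * q + x * r ∧ Bd hS r n := by
  let P : AddSubgroup S :=
    { carrier := {s | ∃ q r, s = c * q + x * r ∧ Bd hS r n}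
      zero_mem' := ⟨0, 0, by simp, Bd.zero hS n⟩
      add_mem' := by
        rintro _ _ ⟨q, r, rfl, h⟩ ⟨q', r', rfl, h'⟩
        exact ⟨q + q', r + r', by rw [mul_add, mul_add]; abel, h.add hS h'⟩
      neg_mem' := by
        rintro _ ⟨q, r, rfl, h⟩
        refine ⟨-q, -r, by rw [mul_neg, mul_neg]; abel, ?_⟩
        have := (Bd.zero hS n).sub hS h
        rwa [zero_sub] at this }
  have hP : ∀ s ∈ P, ∀ r, s * φ r ∈ P := by
    rintro _ ⟨q, r, rfl, h⟩ t
    exact ⟨q * φ t, r * φ t, by simp only [add_mul, mul_assoc], h.mul_phi hS t⟩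
  have main := nak hS P hP n ?_
  · obtain ⟨q, r, rfl, hr⟩ := rdiv hS hc s
    exact P.add_mem ⟨q, 0, by simp, Bd.zero hS n⟩ (main r hr)
  · intro s hs
    obtain ⟨A, B, hAB⟩ := hx
    obtain ⟨a, ha, -⟩ := pr_surj hS (pr hS s * A)
    obtain ⟨q1, r1, h1, hr1⟩ := rdiv hS hc a
    obtain ⟨b, hb, -⟩ := pr_surj hS (pr hS s * B)
    have h1' := congrArg (pr hS) h1
    rw [ha, map_add, map_mul] at h1'
    have h2 : pr hS (s - x * r1 - c * (b + x * q1)) = 0 := by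
      simp only [map_sub, map_mul, map_add, hb]
      linear_combination (-pr hS s) * hAB + pr hS x * h1'
    obtain ⟨w, hw, -⟩ := of_pr' hS h2
    obtain ⟨q3, r3, h3, hr3⟩ := rdiv hS hc w
    refine ⟨c * (b + x * q1 + q3 * φ PowerSeries.X) + x * r1, ⟨_, _, rfl, hr1⟩, r3, hr3, ?_⟩
    have h4 : s = c * (b + x * q1) + x * r1 + w * φ PowerSeries.X := by rw [← hw]; abel
    rw [h4, h3]
    simp only [mul_add, add_mul, mul_assoc]; abel

lemma inter {c c2 x x' : S} {n : ℕ} (hc : Reg hS c n) (hc2 : Reg hS c2 n)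
    (hx : IsCoprime (pr hS x) (pr hS c)) (h : x * c2 = c * x') {t t' : S} (ht : c * t = x * t') :
    ∃ q, t = x' * q ∧ t' = c2 * q := by
  have key : ∀ m, ∀ y r, Bd hS r n → c * y = x * r → ∀ i, PowerSeries.X ^ m ∣ co hS r i := by
    intro m
    induction m with
    | zero => intro y r _ _ i; simp
    | succ m ih =>
      intro y r hr hy i
      have h1 := congrArg (pr hS) hy
      rw [map_mul, map_mul] at h1
      have h2 : pr hS c ∣ pr hS r := hx.symm.dvd_of_dvd_mul_left ⟨_, h1.symm⟩
      have h3 := hr.pr_zero hS (hc.natDegree hS) h2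
      rw [h3, mul_zero] at h1
      have h4 := (mul_eq_zero.1 h1).resolve_left (hc.pr_ne hS)
      obtain ⟨r1, e1, b1⟩ := of_pr' hS h3
      obtain ⟨y1, e2, -⟩ := of_pr' hS h4
      have h5 := ih y1 r1 (b1 n hr)
        (rcancel hS (phiX_ne hS) (by rw [mul_assoc, ← e2, hy, mul_assoc, ← e1])) i
      rw [e1, co_mul_phi, pow_succ]
      apply mul_dvd_mul h5
      rw [PowerSeries.X_dvd_iff, cc_alg]; simp
  obtain ⟨q, r, e, hr⟩ := rdiv hS hc2 t'
  have h1 : c * (t - x' * q) = x * r := by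
    rw [mul_sub, ht, e, mul_add, ← mul_assoc, ← mul_assoc, h]; abel
  have h2 : r = 0 := eq_zero_of_dvd hS (fun m i => key m _ r hr h1 i)
  rw [h2, mul_zero] at h1
  refine ⟨q, ?_, by rw [e, h2, add_zero]⟩
  by_contra hne
  exact mul_ne hS (hc.ne hS) (sub_ne_zero.2 hne) h1

lemma move {c x : S} {n : ℕ} (hc : Reg hS c n) (hx : IsCoprime (pr hS x) (pr hS c)) :
    ∃ c2 x', Reg hS c2 n ∧ x * c2 = c * x' := by
  obtain ⟨q, r, h, hr⟩ := span_all hS hc hx (x * θ ^ n)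
  refine ⟨θ ^ n - r, q, ⟨(Bd.theta hS n (n+1) (Nat.lt_succ_self _)).sub hS (hr.mono hS (Nat.le_succ _)), ?_⟩, ?_⟩
  · rw [map_sub, Finsupp.sub_apply, hr n le_rfl, co_theta, Finsupp.single_eq_same, sub_zero]
    exact isUnit_one
  · rw [mul_sub, h]; abel

lemma comax {c x : S} {n : ℕ} (hc : Reg hS c n) (hx : IsCoprime (pr hS x) (pr hS c)) :
    ∃ u v, c * u + x * v = 1 := by
  obtain ⟨q, r, h, -⟩ := span_all hS hc hx 1
  exact ⟨q, r, h.symm⟩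

lemma hensel {z : S} {n : ℕ} (hz : pr hS z ≠ 0) (hn : (pr hS z).natDegree = n) :
    ∃ b c, z = b * c ∧ Reg hS c n ∧ IsUnit (pr hS b) := by
  classical
  have s1 : ∀ s, ∃ q e r, s = q * z + φ PowerSeries.X * e + r ∧ Bd hS r n := by
    intro s
    obtain ⟨F, hF, hF'⟩ := pr_surj hS (pr hS z)
    have hReg : Reg hS F n := by
      constructor
      · intro i hi
        rw [hF', Polynomial.coeff_eq_zero_of_natDegree_lt (by omega), map_zero]
      · rw [hF', PowerSeries.isUnit_iff_constantCoeff, PowerSeries.constantCoeff_C, ← hn]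
        exact (Polynomial.leadingCoeff_ne_zero.2 hz).isUnit
    obtain ⟨q, r, e, hr⟩ := ldiv hS hReg s
    obtain ⟨t, ht, -⟩ := of_pr hS (s := q * (F - z)) (by rw [map_mul, map_sub, hF, sub_self, mul_zero])
    refine ⟨q, t, r, ?_, hr⟩
    rw [← ht, e, mul_sub]; abel
  have s2 : ∀ m s, ∃ q e r, s = q * z + φ PowerSeries.X ^ m * e + r ∧ Bd hS r n := by
    intro m s
    induction m with
    | zero => exact ⟨0, s, 0, by simp, Bd.zero hS n⟩
    | succ m ih =>
      obtain ⟨q, e, r, h, hr⟩ := ih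
      obtain ⟨q1, e1, r1, h1, hr1⟩ := s1 e
      refine ⟨q + φ PowerSeries.X ^ m * q1, e1, r + φ PowerSeries.X ^ m * r1, ?_, ?_⟩
      · rw [h]; nth_rw 1 [h1]; simp only [pow_succ, mul_add, add_mul, mul_assoc]; abel
      · refine hr.add hS ?_
        rw [← map_pow]; exact hr1.phi_mul hS _
  have s3 : ∀ m q e r, Bd hS r n → r = q * z + φ PowerSeries.X ^ m * e →
      ∀ i, PowerSeries.X ^ m ∣ co hS r i := by
    intro m
    induction m with
    | zero => intro q e r _ _ i; simp
    | succ m ih =>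
      intro q e r hr h i
      have h1 := congrArg (pr hS) h
      rw [pow_succ', map_add, map_mul, map_mul, map_mul, pr_X, zero_mul, zero_mul, add_zero] at h1
      have h2 := hr.pr_zero hS hn ⟨_, h1.trans (mul_comm _ _)⟩
      rw [h2] at h1
      have h3 := (mul_eq_zero.1 h1.symm).resolve_right hz
      obtain ⟨r1, er, br⟩ := of_pr hS h2
      obtain ⟨q1, eq, -⟩ := of_pr hS h3
      have := ih q1 e r1 (br n hr) (lcancel hS (phiX_ne hS) (by
        rw [← er, h, eq, pow_succ', mul_add]; simp only [mul_assoc])) i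
      rw [er, co_phi_mul, pow_succ']
      exact mul_dvd_mul_left _ this
  choose Q E p hp hpB using fun m => s2 m (θ ^ n)
  have s4 : ∀ m l, m ≤ l → ∀ i, PowerSeries.X ^ m ∣ co hS (p l - p m) i := by
    intro m l hml
    obtain ⟨j, rfl⟩ := Nat.exists_eq_add_of_le hml
    apply s3 m (Q m - Q (m+j)) (E m - φ PowerSeries.X ^ j * E (m+j)) _ ((hpB _).sub hS (hpB _))
    have e1 := hp m
    have e2 := hp (m+j)
    have e3 : p (m+j) - p m = (Q m * z + φ PowerSeries.X ^ m * E m) -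
        (Q (m+j) * z + φ PowerSeries.X ^ (m+j) * E (m+j)) := by
      rw [sub_eq_sub_iff_add_eq_add, add_comm, ← e2]; exact e1
    rw [e3, pow_add]
    simp only [sub_mul, mul_sub, mul_assoc]; abel
  let P : S := ev φ θ (Finsupp.onFinset (Finset.range n)
    (fun i => if i < n then PowerSeries.mk (fun j => PowerSeries.coeff j (co hS (p (j+1)) i)) else 0)
    (by intro i hi; by_contra h; apply hi; rw [if_neg (by simpa using h)]))
  have hPB : Bd hS P n := by
    intro i hi
    simp only [P, co_ev]
    simp [hi]
  have s5 : ∀ m i, PowerSeries.X ^ m ∣ co hS (P - p m) i := by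
    intro m i
    by_cases hi : i < n
    · rw [PowerSeries.X_pow_dvd_iff]
      intro j hj
      have := PowerSeries.X_pow_dvd_iff.1 (s4 (j+1) m hj i) j (Nat.lt_succ_self _)
      rw [map_sub, Finsupp.sub_apply, map_sub, sub_eq_zero] at this
      rw [map_sub, Finsupp.sub_apply, map_sub, sub_eq_zero, this]
      simp only [P, co_ev]
      simp [hi]
    · rw [(hPB.sub hS (hpB m)) i (not_lt.1 hi)]; exact dvd_zero _
  have hReg : Reg hS (θ ^ n - P) n := by
    refine ⟨(Bd.theta hS n (n+1) (Nat.lt_succ_self _)).sub hS (hPB.mono hS (Nat.le_succ _)), ?_⟩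
    rw [map_sub, Finsupp.sub_apply, hPB n le_rfl, co_theta, Finsupp.single_eq_same, sub_zero]
    exact isUnit_one
  obtain ⟨b, r, e, hr⟩ := ldiv hS hReg z
  have hr0 : r = 0 := by
    apply eq_zero_of_dvd hS
    intro m
    obtain ⟨t, ht, -⟩ := of_dvd hS (s5 m)
    obtain ⟨y, hy⟩ := Xpow_swap' hS m b
    apply s3 m (1 - b * Q m) (y * (t - E m)) r hr
    have e1 : θ ^ n - P = Q m * z + φ PowerSeries.X ^ m * (E m - t) := by
      nth_rw 1 [hp m]; rw [mul_sub, ← ht]; abel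
    have e2 : r = z - b * (θ ^ n - P) := by nth_rw 1 [e]; abel
    rw [e2, e1, mul_add, ← mul_assoc b (φ _ ^ m), hy]
    simp only [sub_mul, mul_sub, one_mul, mul_assoc]; abel
  rw [hr0, add_zero] at e
  refine ⟨b, _, e, hReg, ?_⟩
  have e' := congrArg (pr hS) e
  rw [map_mul] at e'
  have hb : pr hS b ≠ 0 := by intro h; rw [h, zero_mul] at e'; exact hz e'
  have := Polynomial.natDegree_mul hb (hReg.pr_ne hS)
  rw [← e', hn, hReg.natDegree hS] at this
  exact Polynomial.isUnit_iff_degree_eq_zero.2 (by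
    rw [Polynomial.degree_eq_natDegree hb]; norm_cast; omega)

end
end SkewAux

namespace SkewAux

lemma cop_unit {A : Type u} [CommRing A] {x : A} (hx : IsUnit x) (y : A) : IsCoprime x y := by
  obtain ⟨u, rfl⟩ := hx
  exact ⟨↑u⁻¹, 0, by simp⟩

lemma mem_rSpan {T : Type u} [Ring T] {z t : T} : t ∈ rSpan T z ↔ ∃ q, t = z * q := by
  rw [rSpan, Submodule.mem_span_singleton]
  constructor
  · rintro ⟨a, rfl⟩; exact ⟨a.unop, rfl⟩
  · rintro ⟨q, rfl⟩; exact ⟨op q, rfl⟩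

lemma similar_of {T : Type u} [Ring T] {c b b' : T} (hsurj : ∃ u v, c * u + b' * v = 1)
    (hin : ∀ t, (∃ t', c * t = b' * t') ↔ ∃ q, t = b * q) : SimilarIn T b b' := by
  let g : T →ₗ[Tᵐᵒᵖ] T :=
    { toFun := fun t => c * t
      map_add' := fun s t => mul_add _ _ _
      map_smul' := fun r t => by
        show c * (t * r.unop) = (c * t) * r.unop
        rw [mul_assoc] }
  let f : T →ₗ[Tᵐᵒᵖ] rQuot T b' := (rSpan T b').mkQ.comp g
  have hf : Function.Surjective f := by
    intro y
    obtain ⟨t, rfl⟩ := Submodule.mkQ_surjective _ y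
    obtain ⟨u, v, h⟩ := hsurj
    refine ⟨u * t, ?_⟩
    show (rSpan T b').mkQ (c * (u * t)) = _
    rw [Submodule.mkQ_apply, Submodule.mkQ_apply, eq_comm, Submodule.Quotient.eq, mem_rSpan]
    refine ⟨v * t, ?_⟩
    have : t = (c * u + b' * v) * t := by rw [h, one_mul]
    nth_rw 1 [this]
    simp only [add_mul, mul_assoc]; abel
  have hk : LinearMap.ker f = rSpan T b := by
    ext t
    rw [LinearMap.mem_ker, mem_rSpan, ← hin]
    show (rSpan T b').mkQ (c * t) = 0 ↔ _
    rw [Submodule.mkQ_apply, Submodule.Quotient.mk_eq_zero, mem_rSpan]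
  exact ⟨(Submodule.quotEquivOfEq _ _ hk.symm).trans (f.quotKerEquivOfSurjective hf)⟩

lemma similar_symm {T : Type u} [Ring T] {a b : T} (h : SimilarIn T a b) : SimilarIn T b a :=
  h.elim fun e => ⟨e.symm⟩

lemma similar_pair {S T : Type u} [Ring S] [Ring T] {x : S} {ψ : S →+* T}
    (hT : IsLocalizationAt x ψ) {c b b' c' : S} (e : c * b = b' * c')
    (hu : ∃ u v, c * u + b' * v = 1)
    (hin : ∀ t t', c * t = b' * t' → ∃ q, t = b * q ∧ t' = c' * q) :
    SimilarIn T (ψ b') (ψ b) ∧ SimilarIn T (ψ c') (ψ c) := by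
  have hT2 : ∀ t t', ψ c * t = ψ b' * t' → ∃ q, t = ψ b * q ∧ t' = ψ c' * q := by
    intro t t' h
    obtain ⟨s, m, hs⟩ := hT.surj t
    obtain ⟨s', m', hs'⟩ := hT.surj t'
    have h1 : t * ψ x ^ (m + m') = ψ (s * x ^ m') := by
      rw [pow_add, ← mul_assoc, hs, map_mul, map_pow]
    have h2 : t' * ψ x ^ (m + m') = ψ (s' * x ^ m) := by
      rw [add_comm, pow_add, ← mul_assoc, hs', map_mul, map_pow]
    obtain ⟨q, hq, hq'⟩ := hin (s * x ^ m') (s' * x ^ m) (hT.inj (by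
      rw [map_mul ψ c, map_mul ψ b', ← h1, ← h2, ← mul_assoc, h, mul_assoc]))
    obtain ⟨y, hy⟩ := hT.unit.pow (m + m')
    rw [← hy, hq, map_mul] at h1
    rw [← hy, hq', map_mul] at h2
    refine ⟨ψ q * ↑y⁻¹, ?_, ?_⟩
    · rw [← mul_assoc, ← h1, Units.mul_inv_cancel_right]
    · rw [← mul_assoc, ← h2, Units.mul_inv_cancel_right]
  have eT : ψ c * ψ b = ψ b' * ψ c' := by rw [← map_mul, e, map_mul]
  obtain ⟨u, v, huv⟩ := hu
  have huT : ψ c * ψ u + ψ b' * ψ v = 1 := by rw [← map_mul, ← map_mul, ← map_add, huv, map_one]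
  constructor
  · apply similar_symm
    apply similar_of (c := ψ c) ⟨_, _, huT⟩
    intro t
    constructor
    · rintro ⟨t', h⟩
      obtain ⟨q, h, -⟩ := hT2 _ _ h
      exact ⟨q, h⟩
    · rintro ⟨q, rfl⟩
      exact ⟨ψ c' * q, by rw [← mul_assoc, eT, mul_assoc]⟩
  · apply similar_of (c := ψ b') ⟨_, _, (add_comm _ _).trans huT⟩
    intro t
    constructor
    · rintro ⟨t', h⟩
      obtain ⟨q, -, h⟩ := hT2 _ _ h.symm
      exact ⟨q, h⟩
    · rintro ⟨q, rfl⟩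
      exact ⟨ψ b * q, by rw [← mul_assoc, ← eT, mul_assoc]⟩

section
variable {k : Type u} [Field k] {α : PowerSeries k ≃ₐ[k] PowerSeries k}
  {S : Type u} [Ring S] {φ : PowerSeries k →+* S} {θ : S}
  (hS : IsSkewPolynomialRing α.toRingEquiv φ θ)
include hS

lemma natDegree_unit {s : S} (h : IsUnit s) : (pr hS s).natDegree = 0 :=
  Polynomial.natDegree_eq_zero_of_isUnit (h.map (pr hS))

lemma Reg.isUnit {s : S} (h : Reg hS s 0) : IsUnit s := by
  have : s = φ (co hS s 0) := by
    apply co_ext hS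
    intro n
    rw [co_phi, Finsupp.single_apply]
    split_ifs with h0
    · rw [h0]
    · exact h.1 n (by omega)
  rw [this]
  exact h.2.map φ

lemma reg_factors {c x y : S} {n : ℕ} (hc : Reg hS c n) (h : c = x * y) :
    ∃ d e, Reg hS x d ∧ Reg hS y e ∧ d + e = n := by
  have hx : x ≠ 0 := by rintro rfl; rw [zero_mul] at h; exact hc.ne hS h
  have hy : y ≠ 0 := by rintro rfl; rw [mul_zero] at h; exact hc.ne hS h
  obtain ⟨d, hd, hd'⟩ := exists_deg hS hx
  obtain ⟨e, he, he'⟩ := exists_deg hS hy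
  have h1 := co_mul_top hS hd he
  have h2 := Bd.mul hS hd he
  rw [← h] at h1 h2
  have h3 : co hS c (d + e) ≠ 0 := by
    rw [h1]
    exact mul_ne_zero hd' (fun h => he' ((map_eq_zero_iff _ (α ^ d).injective).1 h))
  have h4 : d + e = n := by
    rcases lt_trichotomy (d + e) n with hl | hl | hl
    · exact absurd hc.2 (by rw [h2 n hl]; exact not_isUnit_zero)
    · exact hl
    · exact absurd (hc.1 _ hl) h3
  have h5 := hc.2
  rw [← h4, h1] at h5
  have h6 := isUnit_of_mul_isUnit_right h5
  refine ⟨d, e, ⟨hd, isUnit_of_mul_isUnit_left h5⟩, ⟨he, ?_⟩, h4⟩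
  have := h6.map (α ^ d).symm
  rwa [AlgEquiv.symm_apply_apply] at this

lemma irr_b {c b b' c' : S} {n : ℕ} (hc : Reg hS c n) (hc' : Reg hS c' n)
    (e : c * b = b' * c') (hb' : IsUnit (pr hS b')) (hb : Irreducible b) : Irreducible b' := by
  have hcop : ∀ x, IsUnit (pr hS x) → IsCoprime (pr hS x) (pr hS c) :=
    fun x hx => cop_unit hx _
  obtain ⟨u, v, huv⟩ := comax hS hc (hcop _ hb')
  constructor
  · intro hu
    obtain ⟨w, hw⟩ := hu
    obtain ⟨q, hq, -⟩ := inter hS hc hc' (hcop _ hb') e.symm (t := 1) (t' := ↑w⁻¹ * c)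
      (by rw [← hw, Units.mul_inv_cancel_left, mul_one])
    exact hb.not_isUnit (isUnit_of_mul hS hq.symm)
  · intro x y hxy
    have hx : IsUnit (pr hS x) := by
      rw [hxy, map_mul] at hb'; exact isUnit_of_mul_isUnit_left hb'
    obtain ⟨c2, x', hc2, h2⟩ := move hS hc (hcop _ hx)
    obtain ⟨q, hq, -⟩ := inter hS hc hc2 (hcop _ hx) h2 (t := b) (t' := y * c')
      (by rw [e, hxy, mul_assoc])
    rcases hb.isUnit_or_isUnit hq with hu | hu
    · left
      obtain ⟨w, rfl⟩ := hu
      obtain ⟨u2, v2, h3⟩ := comax hS hc (hcop _ hx)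
      apply isUnit_of_mul hS (s := c2 * ↑w⁻¹ * u2 + v2)
      rw [mul_add, ← mul_assoc, ← mul_assoc, h2, Units.mul_inv_cancel_right, h3]
    · right
      obtain ⟨w, rfl⟩ := hu
      have h3 : c * (u * x) = x * (1 - y * (v * x)) := by
        have : c * u = 1 - b' * v := by rw [← huv]; abel
        rw [← mul_assoc, this, hxy]; simp only [sub_mul, mul_sub, mul_one, one_mul, mul_assoc]
      obtain ⟨g, hg, -⟩ := inter hS hc hc2 (hcop _ hx) h2 h3
      have h4 : x' = b * ↑w⁻¹ := by rw [hq, Units.mul_inv_cancel_right]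
      have hx0 : x ≠ 0 := by rintro rfl; rw [map_zero] at hx; exact not_isUnit_zero hx
      apply isUnit_of_mul hS (s := c' * (↑w⁻¹ * g) + v * x)
      apply lcancel hS hx0
      rw [← mul_assoc, ← hxy, mul_add, ← mul_assoc, ← e, mul_assoc c, ← mul_assoc b, ← h4, ← hg,
        ← mul_assoc, ← mul_assoc, ← add_mul, huv, one_mul, mul_one]

lemma irr_c {c b b' c' : S} {n : ℕ} (hn : 1 ≤ n) (hc : Reg hS c n) (hc' : Reg hS c' n)
    (e : c * b = b' * c') (hb' : IsUnit (pr hS b')) (hb : IsUnit (pr hS b))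
    (hci : Irreducible c) : Irreducible c' := by
  have hcop : IsCoprime (pr hS b') (pr hS c) := cop_unit hb' _
  obtain ⟨u, v, huv⟩ := comax hS hc hcop
  have hb0 : b' ≠ 0 := by rintro rfl; rw [map_zero] at hb'; exact not_isUnit_zero hb'
  constructor
  · intro h
    have := natDegree_unit hS h
    rw [hc'.natDegree hS] at this
    omega
  · intro x y hxy
    obtain ⟨d, d', hx, hy, hdn⟩ := reg_factors hS hc' hxy
    have hdvd : pr hS x ∣ pr hS c := by
      have h1 := congrArg (pr hS) e
      rw [hxy, map_mul, map_mul, map_mul] at h1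
      have : pr hS x ∣ pr hS c * pr hS b := ⟨pr hS b' * pr hS y, by rw [h1]; ring⟩
      exact hb.dvd_mul_right.1 this
    have hcv : IsCoprime (pr hS v) (pr hS x) := by
      apply IsCoprime.of_isCoprime_of_dvd_right _ hdvd
      have h1 := congrArg (pr hS) huv
      rw [map_add, map_mul, map_mul, map_one] at h1
      exact ⟨pr hS b', pr hS u, by rw [← h1]; ring⟩
    obtain ⟨e0, v', he0, h0⟩ := move hS hx hcv
    have h1 : c * (1 - u * c) = b' * (v * c) := by
      have : b' * v = 1 - c * u := by rw [← huv]; abel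
      rw [← mul_assoc, this]; simp only [sub_mul, mul_sub, one_mul, mul_one, mul_assoc]
    obtain ⟨q, -, hq⟩ := inter hS hc hc' hcop e.symm h1
    obtain ⟨g, -, hg⟩ := inter hS hx he0 hcv h0 (t := y * q) (t' := c)
      (by rw [hq, hxy, mul_assoc])
    rcases hci.isUnit_or_isUnit hg with hu | hu
    · left
      have := natDegree_unit hS hu
      rw [he0.natDegree hS] at this
      subst this
      exact hx.isUnit hS
    · right
      have h2 := congrArg (fun s => (pr hS s).natDegree) hg
      simp only [map_mul] at h2
      rw [Polynomial.natDegree_mul (he0.pr_ne hS) (hu.map (pr hS)).ne_zero, he0.natDegree hS,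
        hc.natDegree hS, natDegree_unit hS hu] at h2
      have : d' = 0 := by omega
      subst this
      exact hy.isUnit hS

end
end SkewAux

/-- Let `b` and `c` be irreducible elements of `Ŝ = k[[X]][θ; α]`
(`α` of infinite order), respectively of type (B) and of type (C).  Then there exist
irreducible elements `b'` and `c'` of `Ŝ`, respectively similar to `b` and to `c`
(in `T = Ŝ⟨X⁻¹⟩`), such that `cb = b'c'`. -/
theorem monoid_commutativity_for_skew_power_series
    {k : Type u} [Field k] (α : PowerSeries k ≃ₐ[k] PowerSeries k)
    (hord : ∀ n : ℕ, 0 < n → α ^ n ≠ 1)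
    {S : Type u} [Ring S] (φ : PowerSeries k →+* S) (θ : S)
    (hS : IsSkewPolynomialRing α.toRingEquiv φ θ)
    {T : Type u} [Ring T] (ψ : S →+* T)
    (hT : IsLocalizationAt (φ PowerSeries.X) ψ)
    (b c : S) (hb : Irreducible b) (hbB : IsTypeB PowerSeries.X φ b)
    (hc : Irreducible c) (hcC : IsTypeC k PowerSeries.X φ θ c) :
    ∃ b' c' : S, Irreducible b' ∧ Irreducible c' ∧
      SimilarIn T (ψ b') (ψ b) ∧ SimilarIn T (ψ c') (ψ c) ∧ c * b = b' * c' := by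
  obtain ⟨ub, sb, -, hub⟩ := hbB
  obtain ⟨uc, f, sc, hfm, hf1, huc, -⟩ := hcC
  have hbU : IsUnit (SkewAux.pr hS b) := by
    have h := congrArg (SkewAux.pr hS) hub
    rw [map_mul, map_add, map_mul, SkewAux.pr_X, zero_mul, add_zero, map_one, mul_comm] at h
    exact IsUnit.of_mul_eq_one _ h
  have h := congrArg (SkewAux.pr hS) huc
  rw [map_mul, map_add, map_mul, SkewAux.pr_X, zero_mul, add_zero, SkewAux.pr_thetaPoly] at h
  have hc0 : SkewAux.pr hS c ≠ 0 := by
    intro h0; rw [h0, mul_zero] at h; exact hfm.ne_zero h.symm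
  have hn : (SkewAux.pr hS c).natDegree = f.natDegree := by
    rw [← h, Polynomial.natDegree_mul (uc.isUnit.map (SkewAux.pr hS)).ne_zero hc0,
      SkewAux.natDegree_unit hS uc.isUnit, zero_add]
  obtain ⟨w, c1, hw, hc1, -⟩ := SkewAux.hensel hS hc0 hn
  have hwu : IsUnit w := by
    rcases hc.isUnit_or_isUnit hw with h | h
    · exact h
    · have := SkewAux.natDegree_unit hS h
      rw [hc1.natDegree hS] at this
      omega
  obtain ⟨w, rfl⟩ := hwu
  have hc1i : Irreducible c1 := by rw [hw] at hc; exact (irreducible_units_mul w).1 hc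
  have hz0 : SkewAux.pr hS (c1 * b) ≠ 0 := by
    rw [map_mul]; exact mul_ne_zero (hc1.pr_ne hS) hbU.ne_zero
  have hzn : (SkewAux.pr hS (c1 * b)).natDegree = f.natDegree := by
    rw [map_mul, Polynomial.natDegree_mul (hc1.pr_ne hS) hbU.ne_zero, hc1.natDegree hS,
      Polynomial.natDegree_eq_zero_of_isUnit hbU, add_zero]
  obtain ⟨b1, c', e, hc', hb1⟩ := SkewAux.hensel hS hz0 hzn
  have hcop : IsCoprime (SkewAux.pr hS b1) (SkewAux.pr hS c1) := SkewAux.cop_unit hb1 _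
  have e' : c * b = ↑w * b1 * c' := by rw [hw, mul_assoc, e, mul_assoc]
  obtain ⟨u, v, huv⟩ := SkewAux.comax hS hc1 hcop
  obtain ⟨h1, h2⟩ := SkewAux.similar_pair hT e'
    ⟨u * ↑w⁻¹, v * ↑w⁻¹, by
      have : c * (u * ↑w⁻¹) + ↑w * b1 * (v * ↑w⁻¹) = ↑w * (c1 * u + b1 * v) * ↑w⁻¹ := by
        rw [hw]; simp only [mul_add, add_mul, mul_assoc]
      rw [this, huv, mul_one, Units.mul_inv]⟩
    (fun t t' ht => SkewAux.inter hS hc1 hc' hcop e.symm (by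
      rw [hw, mul_assoc, mul_assoc] at ht
      exact w.isUnit.mul_left_cancel ht))
  have i1 : Irreducible b1 := SkewAux.irr_b hS hc1 hc' e hb1 hb
  have i2 : Irreducible c' := SkewAux.irr_c hS hf1 hc1 hc' e hb1 hbU hc1i
  have i3 : Irreducible ((w : S) * b1) := (irreducible_units_mul w).2 i1
  exact ⟨(w : S) * b1, c', i3, i2, h1, h2, e'⟩
end

section
/- Let 1 ≤ n < m and let z = Σ_{i=0}^{n} f_i θ^i + Σ_{i=n+1}^{m} g_i θ^i ∈ Ŝ, where f_i, g_i ∈ k[[X]] and g_m ≠ 0. Suppose that f_n is invertible in k[[X]] (i.e. X ∤ f_n) and that g_i ∈ Xk[[X]] (i.e. g_i is not invertible) for all i = n+1, …, m. Then z is divisible on the right by a polynomial in θ of degree n which is monic in θ; in particular, z is a reducible element of Ŝ. -/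
open MulOpposite

universe u

section SkewAux

variable {R S : Type u} [CommRing R] [Ring S] (α : R ≃+* R) (φ : R →+* S) (θ : S)

/-- Elements of degree `< N`. -/
def degLT (N : ℕ) : AddSubgroup S where
  carrier := {s | ∃ h : ℕ → R, s = ∑ i ∈ Finset.range N, φ (h i) * θ ^ i}
  add_mem' := by
    rintro a b ⟨h, rfl⟩ ⟨h', rfl⟩
    exact ⟨fun i => h i + h' i, by simp [add_mul, Finset.sum_add_distrib]⟩
  zero_mem' := ⟨fun _ => 0, by simp⟩
  neg_mem' := by
    rintro a ⟨h, rfl⟩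
    exact ⟨fun i => - h i, by simp⟩

variable {φ θ}

theorem mono_mem_degLT {N i : ℕ} (hi : i < N) (r : R) : φ r * θ ^ i ∈ degLT φ θ N := by
  refine ⟨fun j => if j = i then r else 0, ?_⟩
  rw [Finset.sum_eq_single i]
  · simp
  · intro b _ hb; simp [hb]
  · intro h; exact absurd (Finset.mem_range.2 hi) h

theorem degLT_mono {N M : ℕ} (h : N ≤ M) {s : S} (hs : s ∈ degLT φ θ N) : s ∈ degLT φ θ M := by
  obtain ⟨c, rfl⟩ := hs
  exact sum_mem fun i hi => mono_mem_degLT (lt_of_lt_of_le (Finset.mem_range.1 hi) h) _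

variable {α}

theorem skew_pow (hS : IsSkewPolynomialRing α φ θ) (i : ℕ) (r : R) :
    θ ^ i * φ r = φ ((α ^ i) r) * θ ^ i := by
  induction i generalizing r with
  | zero => simp
  | succ i ih =>
    rw [pow_succ, mul_assoc, hS.commutes, ← mul_assoc, ih, mul_assoc, pow_succ]
    rfl

theorem mono_mul (hS : IsSkewPolynomialRing α φ θ) (i j : ℕ) (a b : R) :
    (φ a * θ ^ i) * (φ b * θ ^ j) = φ (a * (α ^ i) b) * θ ^ (i + j) := by
  rw [mul_assoc, ← mul_assoc (θ ^ i), skew_pow hS, map_mul, pow_add]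
  simp only [mul_assoc]

theorem degLT_mul (hS : IsSkewPolynomialRing α φ θ) {N M K : ℕ} (hK : N + M ≤ K + 1) {a b : S}
    (ha : a ∈ degLT φ θ N) (hb : b ∈ degLT φ θ M) : a * b ∈ degLT φ θ K := by
  obtain ⟨c, rfl⟩ := ha
  obtain ⟨d, rfl⟩ := hb
  rw [Finset.sum_mul_sum]
  refine sum_mem fun i hi => sum_mem fun j hj => ?_
  rw [mono_mul hS]
  rw [Finset.mem_range] at hi hj
  exact mono_mem_degLT (by omega) _

theorem exists_degLT (hS : IsSkewPolynomialRing α φ θ) (s : S) : ∃ N, s ∈ degLT φ θ N := by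
  obtain ⟨p, rfl⟩ := hS.bijective.2 s
  obtain ⟨N, hN⟩ := p.support.exists_nat_subset_range
  exact ⟨N, sum_mem fun i hi => mono_mem_degLT (Finset.mem_range.1 (hN hi)) _⟩

theorem coeff_unique (hS : IsSkewPolynomialRing α φ θ) {N : ℕ} {y : R}
    (h : φ y * θ ^ N ∈ degLT φ θ N) : y = 0 := by
  obtain ⟨c, hc⟩ := h
  have key := @hS.bijective.1 (Finsupp.single N y)
    (∑ i ∈ Finset.range N, Finsupp.single i (c i)) (by
      simp only
      rw [Finsupp.sum_single_index (by simp), hc,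
        ← Finsupp.sum_finsetSum_index (by simp) (by simp [add_mul])]
      refine Finset.sum_congr rfl fun i _ => ?_
      rw [Finsupp.sum_single_index (by simp)])
  have := DFunLike.congr_fun key N
  rw [Finsupp.single_eq_same, Finsupp.finsetSum_apply] at this
  rw [this]
  refine Finset.sum_eq_zero fun i hi => ?_
  rw [Finset.mem_range] at hi
  rw [Finsupp.single_eq_of_ne (by omega)]

/-- `a` has degree `d` and leading coefficient `x`. -/
def Lead (φ : R →+* S) (θ : S) (d : ℕ) (x : R) (a : S) : Prop :=
  x ≠ 0 ∧ a - φ x * θ ^ d ∈ degLT φ θ d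

theorem exists_lead (hS : IsSkewPolynomialRing α φ θ) {s : S} (hs : s ≠ 0) :
    ∃ d x, Lead φ θ d x s := by
  classical
  have h := exists_degLT hS s
  obtain ⟨N, hN, hmin⟩ : ∃ N, s ∈ degLT φ θ N ∧ ∀ M < N, s ∉ degLT φ θ M :=
    ⟨Nat.find h, Nat.find_spec h, fun M hM => Nat.find_min h hM⟩
  obtain ⟨c, hc⟩ := hN
  cases N with
  | zero => simp at hc; exact absurd hc hs
  | succ N =>
    rw [Finset.sum_range_succ] at hc
    refine ⟨N, c N, ?_, c, by rw [hc]; simp⟩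
    intro h0
    exact hmin N (Nat.lt_succ_self N) ⟨c, by rw [hc, h0]; simp⟩

theorem Lead.mem {d : ℕ} {x : R} {a : S} (h : Lead φ θ d x a) : a ∈ degLT φ θ (d + 1) := by
  have := add_mem (degLT_mono (Nat.le_succ d) h.2) (mono_mem_degLT (φ := φ) (θ := θ)
    (Nat.lt_succ_self d) x)
  simpa using this

theorem Lead.mul [IsDomain R] (hS : IsSkewPolynomialRing α φ θ) {d e : ℕ} {x y : R} {a b : S}
    (ha : Lead φ θ d x a) (hb : Lead φ θ e y b) :
    Lead φ θ (d + e) (x * (α ^ d) y) (a * b) := by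
  refine ⟨mul_ne_zero ha.1 ((map_ne_zero_iff _ (α ^ d).injective).2 hb.1), ?_⟩
  have h1 := degLT_mul hS (K := d + e) (by omega) ha.2 hb.mem
  have h2 := degLT_mul hS (K := d + e) (by omega)
    (mono_mem_degLT (φ := φ) (θ := θ) (Nat.lt_succ_self d) x) hb.2
  have := add_mem h1 h2
  rw [← mono_mul hS]
  convert this using 1
  noncomm_ring

theorem Lead.not_mem (hS : IsSkewPolynomialRing α φ θ) {d n : ℕ} {x : R} {a : S}
    (ha : Lead φ θ d x a) (hn : n ≤ d) : a ∉ degLT φ θ n := by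
  intro h
  have := sub_mem (degLT_mono hn h) ha.2
  rw [sub_sub_cancel] at this
  exact ha.1 (coeff_unique hS this)

/-- The monic polynomial with lower coefficients `h`. -/
def mon (φ : R →+* S) (θ : S) (n : ℕ) (h : ℕ → R) : S :=
  (∑ i ∈ Finset.range n, φ (h i) * θ ^ i) + θ ^ n

theorem mon_lead [Nontrivial R] (n : ℕ) (h : ℕ → R) : Lead φ θ n 1 (mon φ θ n h) :=
  ⟨one_ne_zero, h, by simp [mon]⟩

theorem div_unique [IsDomain R] (hS : IsSkewPolynomialRing α φ θ) {n : ℕ} {h : ℕ → R} {u : S}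
    (hu : u * mon φ θ n h ∈ degLT φ θ n) : u = 0 := by
  by_contra h0
  obtain ⟨d, x, hl⟩ := exists_lead hS h0
  exact (hl.mul hS (mon_lead n h)).not_mem hS (by omega) hu

theorem div_exists (hS : IsSkewPolynomialRing α φ θ) (n : ℕ) (h : ℕ → R) (s : S) :
    ∃ u, s - u * mon φ θ n h ∈ degLT φ θ n := by
  obtain ⟨N, hN⟩ := exists_degLT hS s
  induction N generalizing s with
  | zero =>
    exact ⟨0, by simpa using degLT_mono (Nat.zero_le n) hN⟩
  | succ N ih =>
    by_cases hNn : N + 1 ≤ n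
    · exact ⟨0, by simpa using degLT_mono hNn hN⟩
    obtain ⟨c, hc⟩ := hN
    rw [Finset.sum_range_succ] at hc
    obtain ⟨j, rfl⟩ : ∃ j, N = j + n := ⟨N - n, by omega⟩
    obtain ⟨u, hu⟩ := ih (s - (φ (c (j + n)) * θ ^ j) * mon φ θ n h) (by
      have h1 : (φ (c (j + n)) * θ ^ j) * (∑ i ∈ Finset.range n, φ (h i) * θ ^ i)
          ∈ degLT φ θ (j + n) :=
        degLT_mul hS (N := j + 1) (M := n) (by omega) (mono_mem_degLT (Nat.lt_succ_self j) _) ⟨h, rfl⟩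
      have h2 : (∑ i ∈ Finset.range (j + n), φ (c i) * θ ^ i) ∈ degLT φ θ (j + n) := ⟨c, rfl⟩
      convert sub_mem h2 h1 using 1
      rw [hc, mon, mul_add, pow_add]
      noncomm_ring)
    refine ⟨u + φ (c (j + n)) * θ ^ j, ?_⟩
    convert hu using 1
    noncomm_ring

theorem normal_elt (hS : IsSkewPolynomialRing α φ θ) {x : R} (hx : x ∣ α x) (s : S) (j : ℕ) :
    ∃ s', s * φ (x ^ j) = φ (x ^ j) * s' := by
  obtain ⟨N, c, rfl⟩ := exists_degLT hS s
  have hd : ∀ i : ℕ, x ∣ (α ^ i) x := by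
    intro i
    induction i with
    | zero => simp
    | succ i ih =>
      rw [pow_succ']
      exact hx.trans (map_dvd α ih)
  have hd' : ∀ i : ℕ, ∃ y, (α ^ i) (x ^ j) = x ^ j * y := by
    intro i
    rw [map_pow]
    exact pow_dvd_pow_of_dvd (hd i) j
  choose y hy using hd'
  refine ⟨∑ i ∈ Finset.range N, φ (c i * y i) * θ ^ i, ?_⟩
  rw [Finset.sum_mul, Finset.mul_sum]
  refine Finset.sum_congr rfl fun i _ => ?_
  rw [mul_assoc, skew_pow hS, hy, ← mul_assoc, ← mul_assoc, ← map_mul, ← map_mul]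
  congr 2
  ring

/-- The approximation step. -/
theorem approx_step (hS : IsSkewPolynomialRing α φ θ) {x : R} (hx : x ∣ α x) {n : ℕ} {z : S}
    {c v : R} (hcv : c * v = 1) (j : ℕ) (w : S) (h : ℕ → R)
    (h1 : ∃ e, z - w * mon φ θ n h = φ (x ^ (j + 1)) * e) (h2 : ∃ s, w - φ c = φ x * s) :
    ∃ (w' : S) (h' : ℕ → R), (∃ e, z - w' * mon φ θ n h' = φ (x ^ (j + 2)) * e) ∧
      (∃ s, w' - φ c = φ x * s) ∧ ∀ i, x ^ (j + 1) ∣ h' i - h i := by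
  obtain ⟨e, he⟩ := h1
  obtain ⟨s, hs⟩ := h2
  obtain ⟨u, r, hr⟩ := div_exists hS n h e
  set rr := ∑ i ∈ Finset.range n, φ (r i) * θ ^ i with hrr
  obtain ⟨s', hs'⟩ := normal_elt hS hx s (j + 1)
  obtain ⟨u', hu'⟩ := normal_elt hS hx u (j + 1)
  have hm : mon φ θ n (fun i => h i + x ^ (j + 1) * (v * r i))
      = mon φ θ n h + φ (x ^ (j + 1)) * (φ v * rr) := by
    rw [mon, mon, hrr, Finset.mul_sum, Finset.mul_sum]
    simp only [map_add, map_mul, add_mul, Finset.sum_add_distrib, mul_assoc]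
    abel
  refine ⟨w + φ (x ^ (j + 1)) * u, fun i => h i + x ^ (j + 1) * (v * r i), ?_, ?_, ?_⟩
  · refine ⟨- (s' * (φ v * rr) + φ (x ^ j) * (u' * (φ v * rr))), ?_⟩
    rw [hm]
    have hw : w = φ c + φ x * s := by rw [← hs]; abel
    have e1 : e = u * mon φ θ n h + rr := by rw [← hr]; abel
    have a1 : w * (φ (x ^ (j + 1)) * (φ v * rr))
        = φ (x ^ (j + 1)) * rr + φ (x ^ (j + 2)) * (s' * (φ v * rr)) := by
      rw [hw, add_mul]
      congr 1
      · rw [← mul_assoc, ← mul_assoc, ← map_mul, ← map_mul]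
        congr 2
        linear_combination x ^ (j + 1) * hcv
      · rw [mul_assoc, ← mul_assoc s, hs', mul_assoc (φ (x ^ (j + 1))), ← mul_assoc (φ x),
          ← map_mul, ← pow_succ']
    have a2 : φ (x ^ (j + 1)) * u * (φ (x ^ (j + 1)) * (φ v * rr))
        = φ (x ^ (j + 2)) * (φ (x ^ j) * (u' * (φ v * rr))) := by
      rw [mul_assoc, ← mul_assoc u, hu', mul_assoc, ← mul_assoc, ← map_mul, ← mul_assoc (φ (x ^ (j+2))),
        ← map_mul]
      congr 2
      ring
    rw [add_mul, mul_add, mul_add, a1, a2]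
    have he' : z = w * mon φ θ n h + φ (x ^ (j + 1)) * (u * mon φ θ n h + rr) := by
      rw [← e1, ← he]; abel
    rw [he']
    noncomm_ring
  · refine ⟨s + φ (x ^ j) * u, ?_⟩
    rw [mul_add, ← hs, ← mul_assoc, ← map_mul, ← pow_succ']
    abel
  · intro i
    simp

theorem approx_seq (hS : IsSkewPolynomialRing α φ θ) {x : R} (hx : x ∣ α x) {n : ℕ} {z : S}
    {c v : R} (hcv : c * v = 1) (w : S) (h : ℕ → R)
    (h1 : ∃ e, z - w * mon φ θ n h = φ (x ^ 1) * e) (h2 : ∃ s, w - φ c = φ x * s) :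
    ∃ (W : ℕ → S) (H : ℕ → ℕ → R),
      (∀ j, ∃ e, z - W j * mon φ θ n (H j) = φ (x ^ (j + 1)) * e) ∧
      ∀ j i, x ^ (j + 1) ∣ H (j + 1) i - H j i := by
  let T : ℕ → Type u := fun j => {p : S × (ℕ → R) //
    (∃ e, z - p.1 * mon φ θ n p.2 = φ (x ^ (j + 1)) * e) ∧ ∃ s, p.1 - φ c = φ x * s}
  have step : ∀ j (p : T j), ∃ q : T (j + 1), ∀ i, x ^ (j + 1) ∣ q.1.2 i - p.1.2 i := by
    rintro j ⟨⟨w, h⟩, h1, h2⟩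
    obtain ⟨w', h', a, b, d⟩ := approx_step hS hx hcv j w h h1 h2
    exact ⟨⟨(w', h'), a, b⟩, d⟩
  choose F hF using step
  let A : ∀ j, T j := fun j => Nat.rec ⟨(w, h), h1, h2⟩ (fun j p => F j p) j
  exact ⟨fun j => (A j).1.1, fun j => (A j).1.2, fun j => (A j).2.1, fun j => hF j (A j)⟩

theorem rem_divisible [IsDomain R] (hS : IsSkewPolynomialRing α φ θ) {x : R} (hx : x ∣ α x)
    {n : ℕ} {z : S} (W : S) (H h r : ℕ → R) (w : S) (j : ℕ)
    (hW : ∃ e, z - W * mon φ θ n H = φ (x ^ j) * e)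
    (hH : ∀ i, x ^ j ∣ h i - H i)
    (hr : z - w * mon φ θ n h = ∑ i ∈ Finset.range n, φ (r i) * θ ^ i) :
    ∃ r' : ℕ → R, ∑ i ∈ Finset.range n, φ (r i) * θ ^ i =
      φ (x ^ j) * ∑ i ∈ Finset.range n, φ (r' i) * θ ^ i := by
  obtain ⟨e, he⟩ := hW
  choose p hp using hH
  obtain ⟨W', hW'⟩ := normal_elt hS hx W j
  set pp := ∑ i ∈ Finset.range n, φ (p i) * θ ^ i with hpp
  have hm : mon φ θ n h = mon φ θ n H + φ (x ^ j) * pp := by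
    have : h = fun i => H i + x ^ j * p i := by
      funext i; rw [← hp]; ring
    rw [this, mon, mon, hpp, Finset.mul_sum]
    simp only [map_add, map_mul, add_mul, Finset.sum_add_distrib, mul_assoc]
    abel
  obtain ⟨u, r', hr'⟩ := div_exists hS n h (e - W' * pp)
  refine ⟨r', ?_⟩
  have key : (∑ i ∈ Finset.range n, φ (r i) * θ ^ i) -
      φ (x ^ j) * ∑ i ∈ Finset.range n, φ (r' i) * θ ^ i
      = (W - w + φ (x ^ j) * u) * mon φ θ n h := by
    have hz' : z = W * mon φ θ n H + φ (x ^ j) * e := by rw [← he]; abel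
    have h3 : W * mon φ θ n h = W * mon φ θ n H + φ (x ^ j) * (W' * pp) := by
      rw [hm, mul_add, ← mul_assoc W, hW', mul_assoc]
    rw [← hr, ← hr', add_mul, sub_mul, h3, hz']
    noncomm_ring
  have hmem : (W - w + φ (x ^ j) * u) * mon φ θ n h ∈ degLT φ θ n := by
    rw [← key]
    refine sub_mem ⟨r, rfl⟩ ⟨fun i => x ^ j * r' i, ?_⟩
    rw [Finset.mul_sum]
    simp only [map_mul, mul_assoc]
  rw [div_unique hS hmem, zero_mul] at key
  exact sub_eq_zero.1 key

theorem coeffs_unique (hS : IsSkewPolynomialRing α φ θ) {N : ℕ} {r : ℕ → R}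
    (h : ∑ i ∈ Finset.range N, φ (r i) * θ ^ i = 0) : ∀ i < N, r i = 0 := by
  induction N with
  | zero => simp
  | succ N ih =>
    rw [Finset.sum_range_succ] at h
    have h0 : r N = 0 := coeff_unique hS (N := N) ⟨fun i => - r i, by
      rw [← sub_eq_zero]; rw [← h]; simp; abel⟩
    intro i hi
    rcases Nat.lt_succ_iff_lt_or_eq.1 hi with hi | rfl
    · exact ih (by simpa [h0] using h) i hi
    · exact h0

end SkewAux

theorem exists_limit {k : Type u} [Field k] (H : ℕ → PowerSeries k)
    (hH : ∀ j, (PowerSeries.X : PowerSeries k) ^ (j + 1) ∣ H (j + 1) - H j) :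
    ∃ h : PowerSeries k, ∀ j, (PowerSeries.X : PowerSeries k) ^ (j + 1) ∣ h - H j := by
  refine ⟨PowerSeries.mk fun t => PowerSeries.coeff t (H t), fun j => ?_⟩
  rw [PowerSeries.X_pow_dvd_iff]
  intro t ht
  have : ∀ d, PowerSeries.coeff t (H (t + d)) = PowerSeries.coeff t (H t) := by
    intro d
    induction d with
    | zero => rfl
    | succ d ih =>
      have := PowerSeries.X_pow_dvd_iff.1 (hH (t + d)) t (by omega)
      rw [map_sub, sub_eq_zero] at this
      rw [← ih, ← this]; rfl
  obtain ⟨d, rfl⟩ : ∃ d, j = t + d := ⟨j - t, by omega⟩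
  rw [map_sub, PowerSeries.coeff_mk, this, sub_self]

/-- (Converse Eisenstein criterion.)  Let `1 ≤ n < m` and
`z = Σ_{i=0}^{n} fᵢ θ^i + Σ_{i=n+1}^{m} gᵢ θ^i ∈ Ŝ = k[[X]][θ; α]` with `g_m ≠ 0`,
`f_n` invertible in `k[[X]]` and `X ∣ gᵢ` for all `i = n+1, …, m`.  Then `z` is
divisible on the right by a polynomial in `θ` of degree `n` which is monic in `θ`;
in particular `z` is reducible. -/
theorem right_divisor_of_skew_power_series_poly
    {k : Type u} [Field k] (α : PowerSeries k ≃ₐ[k] PowerSeries k)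
    {S : Type u} [Ring S] (φ : PowerSeries k →+* S) (θ : S)
    (hS : IsSkewPolynomialRing α.toRingEquiv φ θ)
    (n m : ℕ) (hn : 1 ≤ n) (hnm : n < m)
    (f g : ℕ → PowerSeries k) (hgm : g m ≠ 0)
    (hfn : IsUnit (f n))
    (hg : ∀ i, n + 1 ≤ i → i ≤ m → (PowerSeries.X : PowerSeries k) ∣ g i)
    (z : S)
    (hz : z = (∑ i ∈ Finset.range (n + 1), φ (f i) * θ ^ i) +
      ∑ i ∈ Finset.Icc (n + 1) m, φ (g i) * θ ^ i) :
    (∃ (h : ℕ → PowerSeries k) (w : S),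
        z = w * ((∑ i ∈ Finset.range n, φ (h i) * θ ^ i) + θ ^ n)) ∧
      ∃ a b : S, ¬ IsUnit a ∧ ¬ IsUnit b ∧ z = a * b := by
  have hx : (PowerSeries.X : PowerSeries k) ∣ α.toRingEquiv PowerSeries.X := by
    rw [PowerSeries.X_dvd_iff]
    by_contra hne
    have h1 : IsUnit (α.toRingEquiv (PowerSeries.X : PowerSeries k)) := by
      rw [PowerSeries.isUnit_iff_constantCoeff]
      exact isUnit_iff_ne_zero.2 hne
    have h2 : IsUnit (PowerSeries.X : PowerSeries k) := (MulEquiv.isUnit_map α.toRingEquiv).1 h1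
    rw [PowerSeries.isUnit_iff_constantCoeff] at h2
    simp at h2
  obtain ⟨v, hv⟩ := hfn.exists_right_inv
  have hSn : Nontrivial S := by
    refine ⟨0, 1, fun h01 => ?_⟩
    have := coeff_unique hS (N := 0) (y := 1) (by simp [← h01, (degLT φ θ 0).zero_mem])
    exact one_ne_zero this
  obtain ⟨W, H, hW, hH⟩ := approx_seq hS hx (n := n) (z := z) hv (φ (f n)) (fun i => v * f i) (by
      have hg' : ∀ i, ∃ y, i ∈ Finset.Icc (n + 1) m → g i = PowerSeries.X * y := by
        intro i
        by_cases hi : i ∈ Finset.Icc (n + 1) m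
        · rw [Finset.mem_Icc] at hi
          obtain ⟨y, hy⟩ := hg i hi.1 hi.2
          exact ⟨y, fun _ => hy⟩
        · exact ⟨0, fun h => absurd h hi⟩
      choose y hy using hg'
      refine ⟨∑ i ∈ Finset.Icc (n + 1) m, φ (y i) * θ ^ i, ?_⟩
      have e1 : φ (f n) * mon φ θ n (fun i => v * f i)
          = ∑ i ∈ Finset.range (n + 1), φ (f i) * θ ^ i := by
        rw [mon, mul_add, Finset.mul_sum, Finset.sum_range_succ]
        congr 1
        refine Finset.sum_congr rfl fun i _ => ?_
        rw [← mul_assoc, ← map_mul, ← mul_assoc, hv, one_mul]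
      rw [e1, hz, add_sub_cancel_left, Finset.mul_sum]
      refine Finset.sum_congr rfl fun i hi => ?_
      rw [hy i hi, map_mul, pow_one, mul_assoc]) ⟨0, by simp⟩
  choose h hh using fun i => exists_limit (fun j => H j i) (fun j => hH j i)
  obtain ⟨w, r, hr⟩ := div_exists hS n h z
  have hr0 : ∀ i < n, r i = 0 := by
    intro i hi
    ext t
    obtain ⟨r', hr'⟩ := rem_divisible hS hx (W t) (H t) h r w (t + 1) (hW t) (fun i => hh i t) hr
    have := coeffs_unique hS (N := n) (r := fun i => r i - PowerSeries.X ^ (t + 1) * r' i) (by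
      simp only [map_sub, sub_mul, Finset.sum_sub_distrib, hr', Finset.mul_sum]
      simp [mul_assoc]) i hi
    rw [sub_eq_zero] at this
    rw [this, map_zero]
    exact PowerSeries.X_pow_dvd_iff.1 (dvd_mul_right _ _) t (Nat.lt_succ_self t)
  have hfac : z = w * mon φ θ n h := by
    rw [← sub_eq_zero, hr]
    exact Finset.sum_eq_zero fun i hi => by simp [hr0 i (Finset.mem_range.1 hi)]
  have hzl : Lead φ θ m (g m) z := by
    refine ⟨hgm, ?_⟩
    have : Finset.Icc (n + 1) m = insert m (Finset.Ico (n + 1) m) := by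
      ext i; simp; omega
    rw [hz, this, Finset.sum_insert (by simp)]
    have h1 : (∑ i ∈ Finset.range (n + 1), φ (f i) * θ ^ i) ∈ degLT φ θ m :=
      sum_mem fun i hi => mono_mem_degLT (by rw [Finset.mem_range] at hi; omega) _
    have h2 : (∑ i ∈ Finset.Ico (n + 1) m, φ (g i) * θ ^ i) ∈ degLT φ θ m :=
      sum_mem fun i hi => mono_mem_degLT (by rw [Finset.mem_Ico] at hi; omega) _
    convert add_mem h1 h2 using 1
    abel
  refine ⟨⟨h, w, hfac⟩, w, mon φ θ n h, ?_, ?_, hfac⟩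
  · intro hu
    obtain ⟨a, ha⟩ := hu.exists_left_inv
    have haz : a * z = mon φ θ n h := by rw [hfac, ← mul_assoc, ha, one_mul]
    have ha0 : a ≠ 0 := by rintro rfl; simp at ha
    obtain ⟨d, x, hl⟩ := exists_lead hS ha0
    have := (hl.mul hS hzl).not_mem hS (n := n + 1) (by omega)
    rw [haz] at this
    exact this (mon_lead n h).mem
  · intro hu
    obtain ⟨a, ha⟩ := hu.exists_left_inv
    have ha0 : a = 0 := div_unique hS (n := n) (h := h) (by
      rw [ha]
      simpa using mono_mem_degLT (φ := φ) (θ := θ) (i := 0) hn 1)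
    rw [ha0, zero_mul] at ha
    exact zero_ne_one ha
end
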